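/- arXiv:math/0407152 — 2 statements merged into one kernel-verified Lean document; each statement's English description precedes it below -/
import Mathlib

section
/- Let X ⊆ U_{m,n} be a nonempty n-variety. The following are equivalent: (a) X is irreducible; (b) I_T(X) is a prime ideal of T_{m,n}; (c) I(X) is a prime ideal of G_{m,n}; (d) k_n[X] is a prime ring. -/
set_option linter.unusedSectionVars false

noncomputable section

universe u

-- Throughout, `k` is an algebraically closed base field of characteristic zero.
variable (k : Type) [Field k] [IsAlgClosed k] [CharZero k]

/-- Index type for the `m·n²` commuting variables `x_{ij}^{(h)}`. -/
abbrev MIdx (n m : ℕ) := Fin m × Fin n × Fin n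

/-- The commutative polynomial ring `k[x_{ij}^{(h)}]`. -/
abbrev PolyRing (n m : ℕ) := MvPolynomial (MIdx n m) k

/-- Matrices over the polynomial ring `k[x_{ij}^{(h)}]`. -/
abbrev MatPoly (n m : ℕ) := Matrix (Fin n) (Fin n) (PolyRing k n m)

/-- The space `(M_n)^m` of `m`-tuples of `n×n` matrices over `k`. -/
abbrev MTuple (n m : ℕ) := Fin m → Matrix (Fin n) (Fin n) k

/-- The `h`-th generic `n×n` matrix `X_h = (x_{ij}^{(h)})`. -/
def genericMatrix (n m : ℕ) (h : Fin m) : MatPoly k n m :=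
  Matrix.of fun i j => MvPolynomial.X (h, i, j)

/-- `G_{m,n}`, the algebra of `m` generic `n×n` matrices: the `k`-subalgebra of
`M_n(k[x_{ij}^{(h)}])` generated by the generic matrices. -/
def GMN (n m : ℕ) : Subalgebra k (MatPoly k n m) :=
  Algebra.adjoin k (Set.range (genericMatrix k n m))

/-- Evaluation of the commuting variables at a point `a ∈ (M_n)^m`. -/
def polyEval {n m : ℕ} (a : MTuple k n m) : PolyRing k n m →ₐ[k] k :=
  MvPolynomial.aeval fun x : MIdx n m => a x.1 x.2.1 x.2.2

/-- Evaluation of matrix-valued polynomials at a point `a ∈ (M_n)^m`; under this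
map an element of `G_{m,n}` (or `T_{m,n}`) becomes a `PGL_n`-equivariant polynomial
map `(M_n)^m → M_n`. -/
def evalMat {n m : ℕ} (a : MTuple k n m) :
    MatPoly k n m →ₐ[k] Matrix (Fin n) (Fin n) k :=
  (polyEval k a).mapMatrix

/-- The scalar matrix `tr(p)·1 ∈ M_n(k[x_{ij}^{(h)}])`. -/
def traceScalar {n m : ℕ} (p : MatPoly k n m) : MatPoly k n m :=
  algebraMap (PolyRing k n m) (MatPoly k n m) (Matrix.trace p)

/-- `T_{m,n}`, the trace ring of `G_{m,n}`: the `k`-algebra generated inside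
`M_n(k[x_{ij}^{(h)}])` by `G_{m,n}` together with the traces of its elements. -/
def TMN (n m : ℕ) : Subalgebra k (MatPoly k n m) :=
  Algebra.adjoin k ((GMN k n m : Set (MatPoly k n m)) ∪
    (traceScalar k '' (GMN k n m : Set (MatPoly k n m))))

lemma GMN_le_TMN (n m : ℕ) : GMN k n m ≤ TMN k n m :=
  fun _ hx => Algebra.subset_adjoin (Or.inl hx)

/-- The inclusion `G_{m,n} → T_{m,n}`. -/
def inclGT (n m : ℕ) : ↥(GMN k n m) →+* ↥(TMN k n m) :=
  (Subalgebra.inclusion (GMN_le_TMN k n m) : ↥(GMN k n m) →ₐ[k] ↥(TMN k n m)).toRingHom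

/-- `U_{m,n}`: the set of `m`-tuples of `n×n` matrices generating `M_n` as a
`k`-algebra. -/
def genTuples (n m : ℕ) : Set (MTuple k n m) :=
  {a | Algebra.adjoin k (Set.range a) = ⊤}

/-- Simultaneous conjugation of an `m`-tuple by `g ∈ GL_n(k)`; since scalar
matrices act trivially, this is the `PGL_n`-action on `(M_n)^m`. -/
def conjAct {n m : ℕ} (g : GL (Fin n) k) (a : MTuple k n m) : MTuple k n m :=
  fun i =>
    (g : Matrix (Fin n) (Fin n) k) * a i * ((g⁻¹ : GL (Fin n) k) : Matrix (Fin n) (Fin n) k)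

/-- Zariski closed subsets of `(M_n)^m`. -/
def IsZClosed {n m : ℕ} (C : Set (MTuple k n m)) : Prop :=
  ∃ S : Set (PolyRing k n m), C = {a | ∀ p ∈ S, polyEval k a p = 0}

/-- `X` is an `n`-variety: a closed `PGL_n`-invariant subvariety of `U_{m,n}`,
i.e. `X = X̄ ∩ U_{m,n}` where `X̄` is the Zariski closure of `X` in `(M_n)^m`. -/
def IsNVariety {n m : ℕ} (X : Set (MTuple k n m)) : Prop :=
  X ⊆ genTuples k n m ∧
  (∀ g : GL (Fin n) k, ∀ a ∈ X, conjAct k g a ∈ X) ∧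
  ∃ C, IsZClosed k C ∧ X = C ∩ genTuples k n m

/-- Irreducibility of a subset of `(M_n)^m` with respect to the Zariski topology. -/
def IsIrredSubset {n m : ℕ} (X : Set (MTuple k n m)) : Prop :=
  X.Nonempty ∧ ∀ C₁ C₂ : Set (MTuple k n m), IsZClosed k C₁ → IsZClosed k C₂ →
    X ⊆ C₁ ∪ C₂ → X ⊆ C₁ ∨ X ⊆ C₂

/-- The zero locus in `U_{m,n}` of a set of matrix-valued polynomials. -/
def zeroLocus {n m : ℕ} (S : Set (MatPoly k n m)) : Set (MTuple k n m) :=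
  {a | a ∈ genTuples k n m ∧ ∀ p ∈ S, evalMat k a p = 0}

/-- The zero locus in `U_{m,n}` of a two-sided ideal of a subalgebra `A` of
`M_n(k[x_{ij}^{(h)}])` (such as `G_{m,n}` or `T_{m,n}`). -/
def zeroLocusI {n m : ℕ} {A : Subalgebra k (MatPoly k n m)} (J : TwoSidedIdeal ↥A) :
    Set (MTuple k n m) :=
  {a | a ∈ genTuples k n m ∧ ∀ p : ↥A, p ∈ J → evalMat k a (p : MatPoly k n m) = 0}

/-- The vanishing (two-sided) ideal of a subset `X ⊆ (M_n)^m` in a subalgebra `A`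
of `M_n(k[x_{ij}^{(h)}])`; for `A = G_{m,n}` this is `I(X)`, for `A = T_{m,n}`
this is `I_T(X)`. -/
def vanishIdeal {n m : ℕ} (A : Subalgebra k (MatPoly k n m)) (X : Set (MTuple k n m)) :
    TwoSidedIdeal ↥A :=
  TwoSidedIdeal.mk' {p : ↥A | ∀ a ∈ X, evalMat k a (p : MatPoly k n m) = 0}
    (fun a _ => by simp)
    (fun {p q} hp hq a ha => by
      have : ((p + q : ↥A) : MatPoly k n m) = (p : MatPoly k n m) + q := rfl
      simp [this, map_add, hp a ha, hq a ha])
    (fun {p} hp a ha => by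
      have : ((-p : ↥A) : MatPoly k n m) = -(p : MatPoly k n m) := rfl
      simp [this, map_neg, hp a ha])
    (fun {p q} hq a ha => by
      have : ((p * q : ↥A) : MatPoly k n m) = (p : MatPoly k n m) * q := rfl
      simp [this, map_mul, hq a ha])
    (fun {p q} hp a ha => by
      have : ((p * q : ↥A) : MatPoly k n m) = (p : MatPoly k n m) * q := rfl
      simp [this, map_mul, hp a ha])

/-- Restriction: a matrix-valued polynomial gives an `M_n`-valued function on `X`. -/
def restrictTo {n m : ℕ} (X : Set (MTuple k n m)) :
    MatPoly k n m →ₐ[k] (X → Matrix (Fin n) (Fin n) k) :=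
  Pi.algHom k _ fun a => evalMat k a.val

/-- The PI-coordinate ring `k_n[X] = G_{m,n}/I(X)`, realized concretely as the
algebra of all restrictions to `X` of elements of `G_{m,n}` (i.e. of
`PGL_n`-equivariant morphisms `X → M_n` coming from `G_{m,n}`). -/
def coordRing {n m : ℕ} (X : Set (MTuple k n m)) :
    Subalgebra k (X → Matrix (Fin n) (Fin n) k) :=
  (GMN k n m).map (restrictTo k X)

/-- The ring `T_{m,n}/I_T(X)`, realized concretely as the algebra of all
restrictions to `X` of elements of `T_{m,n}`. -/
def coordTraceRing {n m : ℕ} (X : Set (MTuple k n m)) :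
    Subalgebra k (X → Matrix (Fin n) (Fin n) k) :=
  (TMN k n m).map (restrictTo k X)

/-- A ring is prime if it is nonzero and `a·R·b = 0` implies `a = 0` or `b = 0`. -/
def IsPrimeRing (R : Type u) [Ring R] : Prop :=
  Nontrivial R ∧ ∀ a b : R, (∀ x : R, a * x * b = 0) → a = 0 ∨ b = 0

/-- `Q` is a central simple algebra of degree `n`: a simple ring whose center is a
field, and which has dimension `n²` over its center. -/
def IsCSAOfDegree (n : ℕ) (Q : Type u) [Ring Q] : Prop :=
  IsSimpleRing Q ∧
  ∃ (K : Type u) (_ : Field K) (_ : Algebra K Q),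
    (algebraMap K Q).range = Subring.center Q ∧ Module.finrank K Q = n ^ 2

/-- A (prime PI-) ring `R` has PI-degree `n` if its total ring of fractions — the
central localization of `R` at its nonzero central elements — is a central simple
algebra of degree `n`. -/
def HasPIDegree (n : ℕ) (R : Type u) [Ring R] : Prop :=
  ∃ (Q : Type u) (_ : Ring Q) (f : R →+* Q),
    Function.Injective f ∧
    (∀ c ∈ Subring.center R, c ≠ 0 → IsUnit (f c)) ∧
    (∀ q : Q, ∃ r : R, ∃ c ∈ Subring.center R, c ≠ 0 ∧ q * f c = f r) ∧
    IsCSAOfDegree n Q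

/-- The quotient of a ring by a two-sided ideal. -/
abbrev idealQuot {R : Type u} [Ring R] (J : TwoSidedIdeal R) : Type u := J.ringCon.Quotient

/-- `Spec_n(R)`: the set of prime (two-sided) ideals `J` of `R` such that `R/J` is a
prime ring of PI-degree `n`. -/
def SpecN (n : ℕ) (R : Type u) [Ring R] : Set (TwoSidedIdeal R) :=
  {J | IsPrimeRing (idealQuot J) ∧ HasPIDegree n (idealQuot J)}

/-- A regular map of `n`-varieties `X → Y ⊆ U_{l,n}`: a map of the form
`a ↦ (f₁(a), …, f_l(a))` with each `f_i ∈ k_n[X]`, i.e. each component is the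
restriction to `X` of an element of `G_{m,n}`. -/
def IsRegMapOn {n m l : ℕ} (X : Set (MTuple k n m)) (Y : Set (MTuple k n l))
    (φ : MTuple k n m → MTuple k n l) : Prop :=
  (∀ a ∈ X, φ a ∈ Y) ∧
  ∃ F : Fin l → MatPoly k n m, (∀ i, F i ∈ GMN k n m) ∧
    ∀ a ∈ X, ∀ i, φ a i = evalMat k a (F i)

/-- `X` and `Y` are isomorphic `n`-varieties: there are mutually inverse regular
maps of `n`-varieties between them. -/
def NIsomorphic {n m l : ℕ} (X : Set (MTuple k n m)) (Y : Set (MTuple k n l)) : Prop :=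
  ∃ (φ : MTuple k n m → MTuple k n l) (ψ : MTuple k n l → MTuple k n m),
    IsRegMapOn k X Y φ ∧ IsRegMapOn k Y X ψ ∧
    (∀ a ∈ X, ψ (φ a) = a) ∧ (∀ b ∈ Y, φ (ψ b) = b)
section GenericLemmas
open Polynomial Matrix

lemma aux_derivative_det {R : Type} [CommRing R] {ι : Type} [Fintype ι] [DecidableEq ι]
    (M : Matrix ι ι R[X]) :
    derivative M.det = ∑ i, (M.updateCol i (fun j => derivative (M j i))).det := by
  simp only [det_apply, derivative_sum]
  rw [Finset.sum_comm]
  refine Finset.sum_congr rfl fun σ _ => ?_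
  rw [← Finset.smul_sum]
  have : derivative (Equiv.Perm.sign σ • ∏ i, M (σ i) i)
      = Equiv.Perm.sign σ • derivative (∏ i, M (σ i) i) := by
    rcases Int.units_eq_one_or (Equiv.Perm.sign σ) with h | h <;> simp [h]
  rw [this, derivative_prod_finset]
  congr 1
  refine Finset.sum_congr rfl fun i _ => ?_
  rw [← Finset.mul_prod_erase Finset.univ _ (Finset.mem_univ i), mul_comm]
  congr 1
  · simp
  · refine Finset.prod_congr rfl fun j hj => ?_
    rw [updateCol_ne (Finset.ne_of_mem_erase hj)]

lemma aux_derivative_charpoly {R : Type} [CommRing R] {ι : Type} [Fintype ι] [DecidableEq ι]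
    (r : Matrix ι ι R) :
    derivative r.charpoly = (adjugate (charmatrix r)).trace := by
  rw [Matrix.charpoly, aux_derivative_det, trace]
  refine Finset.sum_congr rfl fun i _ => ?_
  rw [diag_apply, ← Matrix.transpose_apply (adjugate _), adjugate_transpose, adjugate_apply,
    updateRow_transpose, det_transpose]
  congr 2
  funext j
  by_cases h : j = i
  · subst h; simp [charmatrix]
  · simp [charmatrix, h]

/-- Newton type statement: traces against the adjugate of the characteristic matrix. -/
lemma aux_newton {k R : Type} [Field k] [CharZero k] [CommRing R] [Nontrivial R] [Algebra k R]
    {ι : Type} [Fintype ι] [DecidableEq ι] (S : Subalgebra k R)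
    (G : Subalgebra k (Matrix ι ι R)) (hG : ∀ x ∈ G, x.trace ∈ S) (r : Matrix ι ι R) (hr : r ∈ G)
    (x : Matrix ι ι R) (hx : x ∈ G) (j : ℕ) :
    ((x.map C * adjugate (charmatrix r)).trace).coeff j ∈ S := by
  set q := matPolyEquiv (adjugate (charmatrix r)) with hq
  have h1 : (X - C r) * q = r.charpoly.map (algebraMap R (Matrix ι ι R)) := by
    rw [hq, ← matPolyEquiv_charmatrix, ← map_mul, mul_adjugate, ← Matrix.charpoly]
    exact matPolyEquiv_smul_one _
  have hrec : ∀ j, q.coeff j = r * q.coeff (j+1) + algebraMap R _ (r.charpoly.coeff (j+1)) := by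
    intro j
    have := congrArg (fun p => p.coeff (j+1)) h1
    simp only [sub_mul, coeff_sub, coeff_X_mul, coeff_C_mul, coeff_map] at this
    rw [← this]; abel
  have hcoe : ∀ (y : Matrix ι ι R) j,
      ((y.map C * adjugate (charmatrix r)).trace).coeff j = (y * q.coeff j).trace := by
    intro y j
    simp [trace, mul_apply, hq, matPolyEquiv_coeff_apply]
  have hder : ∀ j, (q.coeff j).trace = (r.charpoly.coeff (j+1)) * (j+1) := by
    intro j
    have := hcoe 1 j
    rw [one_mul] at this
    rw [← this, ← coeff_derivative, aux_derivative_charpoly]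
    simp
  have key : ∀ d j, q.natDegree < j + d → ∀ y ∈ G, (y * q.coeff j).trace ∈ S := by
    intro d
    induction d with
    | zero =>
      intro j hj y _
      rw [coeff_eq_zero_of_natDegree_lt (by simpa using hj)]; simp
    | succ d ih =>
      intro j hj y hy
      have ih' := ih (j+1) (by omega)
      have hchi : r.charpoly.coeff (j+1) ∈ S := by
        by_cases hjn : j + 1 = Fintype.card ι
        · have h2 := r.charpoly_monic
          rw [Monic, leadingCoeff, charpoly_natDegree_eq_dim, ← hjn] at h2
          rw [h2]; exact S.one_mem
        · have h2 := hder j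
          rw [hrec j, trace_add, Algebra.algebraMap_eq_smul_one, trace_smul, trace_one] at h2
          have h3 : ((j + 1 : k) - Fintype.card ι) • r.charpoly.coeff (j+1) ∈ S := by
            have : ((j + 1 : k) - Fintype.card ι) • r.charpoly.coeff (j+1)
                = (r * q.coeff (j+1)).trace := by
              rw [Algebra.smul_def]
              simp only [map_sub, map_add, map_natCast, map_one]
              rw [smul_eq_mul] at h2
              linear_combination -h2
            rw [this]; exact ih' r hr
          have hne : ((j + 1 : k) - Fintype.card ι) ≠ 0 := by
            rw [sub_ne_zero]; exact_mod_cast hjn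
          have := S.smul_mem h3 ((j + 1 : k) - Fintype.card ι)⁻¹
          rwa [smul_smul, inv_mul_cancel₀ hne, one_smul] at this
      rw [hrec j, mul_add, trace_add, ← mul_assoc, Algebra.algebraMap_eq_smul_one, mul_smul_comm, trace_smul,
        mul_one]
      exact S.add_mem (ih' _ (G.mul_mem hy hr)) (S.mul_mem hchi (hG y hy))
  rw [hcoe]
  exact key (q.natDegree + 1) j (by omega) x hx

/-- The adjugate of a singular matrix has rank at most one. -/
lemma aux_adj_rank_one {k : Type} [Field k] {ι : Type} [Fintype ι] [DecidableEq ι]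
    (M : Matrix ι ι k) (hM : M.det = 0) :
    ∃ v u : ι → k, adjugate M = vecMulVec v u := by
  by_cases h0 : adjugate M = 0
  · exact ⟨0, 0, by rw [h0]; ext; simp [vecMulVec]⟩
  have : ∃ i j, adjugate M i j ≠ 0 := by
    by_contra h; push Not at h; exact h0 (by ext i j; exact h i j)
  obtain ⟨i, j, hij⟩ := this
  have hMA : M * adjugate M = 0 := by rw [mul_adjugate, hM, zero_smul]
  set M' := M.updateRow j (Pi.single i 1) with hM'
  have hdet : M'.det ≠ 0 := by rw [hM', ← adjugate_apply]; exact hij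
  have hker : ∀ c, M' *ᵥ (fun l => adjugate M l c) = adjugate M i c • Pi.single j 1 := by
    intro c
    ext s
    by_cases hs : s = j
    · subst hs; simp [hM', mulVec]
    · have := congrFun (congrFun hMA s) c
      simp only [mul_apply, Matrix.zero_apply] at this
      simp [hM', mulVec, hs, dotProduct, this]
  refine ⟨fun l => adjugate M l j, fun c => adjugate M i c / adjugate M i j, ?_⟩
  ext l c
  have h2 : M' *ᵥ (adjugate M i c • (fun l => adjugate M l j)
      - adjugate M i j • (fun l => adjugate M l c)) = 0 := by
    rw [mulVec_sub, mulVec_smul, mulVec_smul, hker, hker, smul_smul, smul_smul, mul_comm, sub_self]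
  have h3 := congrFun (eq_zero_of_mulVec_eq_zero hdet h2) l
  simp only [Pi.sub_apply, Pi.smul_apply, smul_eq_mul, Pi.zero_apply] at h3
  rw [vecMulVec_apply]
  field_simp
  linear_combination -h3

lemma aux_trace_aeval_zero {k : Type} [Field k] [IsAlgClosed k] {ι : Type} [Fintype ι]
    [DecidableEq ι] [Nonempty ι] (M : Matrix ι ι k) (P : k[X])
    (hP : ∀ l : k, (Matrix.scalar ι l - M).det = 0 → P.eval l = 0) : (aeval M P).trace = 0 := by
  rw [trace_eq_sum_roots_charpoly]
  refine Multiset.sum_eq_zero fun x hx => ?_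
  have hx' : x ∈ spectrum k (aeval M P) :=
    mem_spectrum_of_isRoot_charpoly (isRoot_of_mem_roots hx)
  rw [spectrum.map_polynomial_aeval_of_nonempty M P (spectrum.nonempty_of_isAlgClosed_of_finiteDimensional k M)] at hx'
  obtain ⟨l, hl, rfl⟩ := hx'
  refine hP l ?_
  rw [← eval_charpoly]
  exact mem_spectrum_iff_isRoot_charpoly.1 hl

lemma aux_idem {k A : Type} [Field k] [Ring A] [Algebra k A] (e : A) (he : e * e = e) (q : k[X]) :
    e * aeval e q = q.eval 1 • e := by
  induction q using Polynomial.induction_on' with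
  | add p q hp hq => simp [mul_add, add_smul, hp, hq]
  | monomial n a =>
    have : e * e ^ n = e := by
      induction n with
      | zero => simp
      | succ n ih => rw [pow_succ, ← mul_assoc, ih, he]
    rw [aeval_monomial, Algebra.commutes, ← mul_assoc, this, ← Algebra.commutes]
    simp [Algebra.smul_def]

lemma aux_sum_updateRow {R : Type} [CommRing R] {ι : Type} [Fintype ι] [DecidableEq ι]
    (M A : Matrix ι ι R) : ∑ i, (M.updateRow i ((M * A) i)).det = A.trace * M.det := by
  have : ∀ i, (M.updateRow i ((M * A) i)).det = (M * A * adjugate M) i i := by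
    intro i
    rw [← cramer_transpose_apply, cramer_eq_adjugate_mulVec, ← adjugate_transpose,
      mulVec_transpose]
    rfl
  simp only [this]
  change trace (M * A * adjugate M) = _
  rw [trace_mul_comm, ← mul_assoc, adjugate_mul, smul_mul_assoc, one_mul, trace_smul, smul_eq_mul,
    mul_comm]

end GenericLemmas
section Homog
open MvPolynomial

/-- Homogenization of `f`, with the extra variable specialized to `δ`. -/
def auxHom {k σ S : Type} [Field k] [CommRing S] [Algebra k S] (f : MvPolynomial σ k)
    (δ : S) (A : σ → S) : S :=
  ∑ d ∈ Finset.range (f.totalDegree + 1),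
    δ ^ (f.totalDegree + 1 - d) * aeval A (homogeneousComponent d f)

lemma auxHom_map {k σ S S' : Type} [Field k] [CommRing S] [Algebra k S] [CommRing S'] [Algebra k S']
    (φ : S →ₐ[k] S') (f : MvPolynomial σ k) (δ : S) (A : σ → S) :
    φ (auxHom f δ A) = auxHom f (φ δ) (fun s => φ (A s)) := by
  unfold auxHom
  rw [map_sum]
  refine Finset.sum_congr rfl fun d _ => ?_
  rw [map_mul, map_pow, ← comp_aeval_apply]

lemma auxHom_zero {k σ S : Type} [Field k] [CommRing S] [Algebra k S] (f : MvPolynomial σ k)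
    (A : σ → S) : auxHom f 0 A = 0 := by
  unfold auxHom
  refine Finset.sum_eq_zero fun d hd => ?_
  rw [Finset.mem_range] at hd
  rw [zero_pow (by omega), zero_mul]

lemma auxHom_smul {k σ S : Type} [Field k] [CommRing S] [Algebra k S] (f : MvPolynomial σ k)
    (δ : S) (A : σ → S) :
    auxHom f δ (fun s => δ * A s) = δ ^ (f.totalDegree + 1) * aeval A f := by
  have h : ∀ d, aeval (fun s => δ * A s) (homogeneousComponent d f)
      = δ ^ d * aeval A (homogeneousComponent d f) := by
    intro d
    have hh := homogeneousComponent_isHomogeneous d f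
    rw [aeval_def, eval₂_eq, aeval_def, eval₂_eq, Finset.mul_sum]
    refine Finset.sum_congr rfl fun s hs => ?_
    have h1 : ∑ i ∈ s.support, s i = d := by
      have := hh (mem_support_iff.1 hs)
      rw [Finsupp.weight_apply] at this
      simpa [Finsupp.sum] using this
    simp only [mul_pow]
    rw [Finset.prod_mul_distrib, Finset.prod_pow_eq_pow_sum, h1]
    ring
  unfold auxHom
  simp only [h]
  have h2 : aeval A f = ∑ d ∈ Finset.range (f.totalDegree + 1),
      aeval A (homogeneousComponent d f) := by
    rw [← map_sum, sum_homogeneousComponent f]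
  rw [h2, Finset.mul_sum]
  refine Finset.sum_congr rfl fun d hd => ?_
  rw [← mul_assoc, ← pow_add]
  rw [Finset.mem_range] at hd
  congr 2
  omega

end Homog

section Razmyslov
open Matrix

variable {k R : Type} [Field k] [CommRing R] [Algebra k R]
  {ι : Type} [Fintype ι] [DecidableEq ι]

/-- Matrix of coordinates of a tuple of matrices. -/
def auxD (y : ι × ι → Matrix ι ι R) : Matrix (ι × ι) (ι × ι) R := Matrix.of fun s p => y s p.1 p.2

/-- Span of coordinate determinants of tuples in `G`. -/
def auxDSpan (G : Subalgebra k (Matrix ι ι R)) : Submodule k R :=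
  Submodule.span k {φ | ∃ y : ι × ι → Matrix ι ι R, (∀ s, y s ∈ G) ∧ φ = (auxD y).det}

/-- Multiplier algebra of `auxDSpan`. -/
def auxS (G : Subalgebra k (Matrix ι ι R)) : Subalgebra k R where
  carrier := {φ | ∀ d ∈ auxDSpan G, φ * d ∈ auxDSpan G}
  mul_mem' := fun {a b} ha hb d hd => by rw [mul_assoc]; exact ha _ (hb _ hd)
  add_mem' := fun {a b} ha hb d hd => by rw [add_mul]; exact add_mem (ha _ hd) (hb _ hd)
  algebraMap_mem' := fun c d hd => by
    rw [← Algebra.smul_def]; exact Submodule.smul_mem _ _ hd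

lemma auxS_trace [CharZero k] [Nonempty ι] (G : Subalgebra k (Matrix ι ι R)) (x : Matrix ι ι R)
    (hx : x ∈ G) : x.trace ∈ auxS G := by
  intro d hd
  induction hd using Submodule.span_induction with
  | zero => rw [mul_zero]; exact zero_mem _
  | add a b _ _ ha hb => rw [mul_add]; exact add_mem ha hb
  | smul c a _ ha => rw [mul_smul_comm]; exact Submodule.smul_mem _ _ ha
  | mem d hd =>
    obtain ⟨y, hy, rfl⟩ := hd
    let A : Matrix (ι × ι) (ι × ι) R := Matrix.of fun p q => if p.2 = q.2 then x q.1 p.1 else 0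
    have hA : A.trace = (Fintype.card ι : R) * x.trace := by
      simp [A, trace, Fintype.sum_prod_type, Finset.mul_sum]
    have h1 := aux_sum_updateRow (auxD y) A
    have h2 : ∀ s, (auxD y).updateRow s ((auxD y * A) s)
        = auxD (Function.update y s (x * y s)) := by
      intro s
      ext t p
      by_cases hts : t = s
      · subst hts
        simp [auxD, A, mul_apply, Fintype.sum_prod_type, mul_comm]
      · simp [auxD, hts]
    have h3 : (Fintype.card ι : k) • (x.trace * (auxD y).det) ∈ auxDSpan G := by
      have : (Fintype.card ι : k) • (x.trace * (auxD y).det)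
          = ∑ s, (auxD (Function.update y s (x * y s))).det := by
        simp only [← h2]
        rw [h1, hA, Algebra.smul_def, map_natCast, mul_assoc]
      rw [this]
      refine sum_mem fun s _ => Submodule.subset_span ⟨_, fun t => ?_, rfl⟩
      by_cases hts : t = s
      · subst hts; simpa using G.mul_mem hx (hy t)
      · simpa [hts] using hy t
    have hne : (Fintype.card ι : k) ≠ 0 := by
      exact_mod_cast Fintype.card_ne_zero
    have := Submodule.smul_mem _ (Fintype.card ι : k)⁻¹ h3
    rwa [smul_smul, inv_mul_cancel₀ hne, one_smul] at this

/-- The Capelli-type multilinear map. -/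
def auxMulti {N : ℕ} (Z Z' : Fin N → Matrix ι ι R) :
    MultilinearMap R (fun _ : Fin N => Matrix ι ι R) (Matrix ι ι R) :=
  (MultilinearMap.mkPiAlgebraFin R N (Matrix ι ι R)).compLinearMap
    fun l => (LinearMap.mulLeft R (Z l)).comp (LinearMap.mulRight R (Z' l))

lemma auxMulti_apply {N : ℕ} (Z Z' y : Fin N → Matrix ι ι R) :
    auxMulti Z Z' y = (List.ofFn fun l => Z l * (y l * Z' l)).prod := by
  simp [auxMulti]

lemma auxAlt_apply {N : ℕ} (Z Z' y : Fin N → Matrix ι ι R) :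
    MultilinearMap.alternatization (auxMulti Z Z') y
      = ∑ σ : Equiv.Perm (Fin N), Equiv.Perm.sign σ •
          (List.ofFn fun l => Z l * (y (σ l) * Z' l)).prod := by
  rw [MultilinearMap.alternatization_apply]
  refine Finset.sum_congr rfl fun σ _ => ?_
  rw [MultilinearMap.domDomCongr_apply, auxMulti_apply]

lemma auxAlt_mem (G : Subalgebra k (Matrix ι ι R)) {N : ℕ} (Z Z' y : Fin N → Matrix ι ι R)
    (hZ : ∀ l, Z l ∈ G) (hZ' : ∀ l, Z' l ∈ G) (hy : ∀ l, y l ∈ G) :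
    MultilinearMap.alternatization (auxMulti Z Z') y ∈ G := by
  rw [auxAlt_apply]
  refine sum_mem fun σ _ => ?_
  have : (List.ofFn fun l => Z l * (y (σ l) * Z' l)).prod ∈ G := by
    refine list_prod_mem fun x hx => ?_
    rw [List.mem_ofFn] at hx
    obtain ⟨l, rfl⟩ := hx
    exact G.mul_mem (hZ l) (G.mul_mem (hy _) (hZ' l))
  rcases Int.units_eq_one_or (Equiv.Perm.sign σ) with h | h
  · rw [h, one_smul]; exact this
  · rw [h]; simpa using this

lemma auxAlt_det {N : ℕ} (e : ι × ι ≃ Fin N) (Z Z' : Fin N → Matrix ι ι R)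
    (y : ι × ι → Matrix ι ι R) :
    MultilinearMap.alternatization (auxMulti Z Z') (fun l => y (e.symm l))
      = (auxD y).det • MultilinearMap.alternatization (auxMulti Z Z')
          (fun l => Matrix.single (e.symm l).1 (e.symm l).2 1) := by
  set b := (Matrix.stdBasis R ι ι).reindex e with hb
  have hbl : ∀ l, b l = Matrix.single (e.symm l).1 (e.symm l).2 1 := by
    intro l
    rw [hb, Module.Basis.reindex_apply]
    exact Matrix.stdBasis_eq_single _ _ _
  have hbf : (fun l => Matrix.single (e.symm l).1 (e.symm l).2 (1 : R)) = b := by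
    funext l; exact (hbl l).symm
  have hdet : b.det (fun l => y (e.symm l)) = (auxD y).det := by
    rw [Module.Basis.det_apply, ← Matrix.det_transpose, ← Matrix.det_submatrix_equiv_self e]
    congr 1
    ext s p
    simp [Module.Basis.toMatrix_apply, auxD, hb, Matrix.stdBasis]
  ext i j
  have h := ((Matrix.entryLinearMap R R i j).compAlternatingMap
    (MultilinearMap.alternatization (auxMulti Z Z'))).eq_smul_basis_det b
  have h1 := congrArg (fun F => F (fun l => y (e.symm l))) h
  simp only [LinearMap.compAlternatingMap_apply, AlternatingMap.smul_apply, hdet] at h1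
  rw [hbf, Matrix.smul_apply, smul_eq_mul, mul_comm]
  exact h1

lemma aux_capelli (G : Subalgebra k (Matrix ι ι R)) (ψ : R →ₐ[k] k) (o : ι)
    (hψ : ∀ c : Matrix ι ι k, ∃ x ∈ G, ψ.mapMatrix x = c) :
    ∃ P : Matrix ι ι R, ψ.mapMatrix P ≠ 0 ∧ ∀ φ ∈ auxDSpan G, φ • P ∈ G := by
  classical
  choose z hzG hz using hψ
  let e := Fintype.equivFin (ι × ι)
  let Z := fun l => z (Matrix.single o (e.symm l).1 1)
  let Z' := fun l => z (Matrix.single (e.symm l).2 o 1)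
  refine ⟨MultilinearMap.alternatization (auxMulti Z Z')
          (fun l => Matrix.single (e.symm l).1 (e.symm l).2 1), ?_, ?_⟩
  · have hcalc : ψ.mapMatrix (MultilinearMap.alternatization (auxMulti Z Z')
          (fun l => Matrix.single (e.symm l).1 (e.symm l).2 1)) = Matrix.single o o 1 ^ (Fintype.card (ι × ι)) := by
      rw [auxAlt_apply, map_sum, Finset.sum_eq_single 1]
      · rw [Equiv.Perm.sign_one, one_smul, map_list_prod, List.map_ofFn]
        have : (ψ.mapMatrix ∘ fun l => Z l * ((Matrix.single
            (e.symm ((1 : Equiv.Perm (Fin (Fintype.card (ι × ι)))) l)).1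
            (e.symm ((1 : Equiv.Perm (Fin (Fintype.card (ι × ι)))) l)).2 (1 : R)) * Z' l))
            = fun _ => Matrix.single o o (1 : k) := by
          funext l
          simp only [Function.comp, map_mul, Z, Z', hz]
          simp [Matrix.map_single]
        rw [this, List.ofFn_const, List.prod_replicate]
      · intro σ _ hσ
        have : ∃ l, σ l ≠ l := by
          by_contra h; push Not at h; exact hσ (Equiv.ext h)
        obtain ⟨l, hl⟩ := this
        have h0 : ψ.mapMatrix ((List.ofFn fun l => Z l * ((Matrix.single (e.symm (σ l)).1
            (e.symm (σ l)).2 (1 : R)) * Z' l)).prod) = 0 := by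
          rw [map_list_prod, List.map_ofFn]
          apply List.prod_eq_zero
          rw [List.mem_ofFn]
          refine ⟨l, ?_⟩
          simp only [Function.comp, map_mul, Z, Z', hz]
          have h2 : e.symm (σ l) ≠ e.symm l := fun h => hl (e.symm.injective h)
          by_cases h3 : (e.symm (σ l)).2 = (e.symm l).2
          · have h4 : (e.symm l).1 ≠ (e.symm (σ l)).1 := fun h => h2 (Prod.ext h.symm h3)
            simp [Matrix.map_single, h3, h4]
          · simp [Matrix.map_single, h3]
        rcases Int.units_eq_one_or (Equiv.Perm.sign σ) with h | h
        · rw [h, one_smul]; exact h0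
        · rw [h, Units.neg_smul, one_smul, map_neg, h0, neg_zero]
      · simp
    rw [hcalc]
    have hid : (Matrix.single o o (1:k)) * Matrix.single o o 1 = Matrix.single o o 1 := by simp
    have hp : ∀ N, (Matrix.single o o (1:k)) ^ (N+1) = Matrix.single o o 1 := by
      intro N
      induction N with
      | zero => simp
      | succ N ih => rw [pow_succ, ih, hid]
    have : Nonempty ι := ⟨o⟩
    have hc : Fintype.card (ι × ι) ≠ 0 := Fintype.card_ne_zero
    obtain ⟨N, hN⟩ := Nat.exists_eq_succ_of_ne_zero hc
    rw [hN, hp]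
    intro h
    have := congrFun (congrFun h o) o
    simp at this
  · intro φ hφ
    induction hφ using Submodule.span_induction with
    | zero => rw [zero_smul]; exact zero_mem _
    | add a b _ _ ha hb => rw [add_smul]; exact add_mem ha hb
    | smul c a _ ha => rw [smul_assoc]; exact G.smul_mem ha c
    | mem d hd =>
      obtain ⟨y, hy, rfl⟩ := hd
      rw [← auxAlt_det]
      exact auxAlt_mem G Z Z' _ (fun l => hzG _) (fun l => hzG _) (fun l => hy _)

end Razmyslov
section Sep
open Matrix

lemma aux_evalMat_generic {n m : ℕ} (a : MTuple k n m) (h : Fin m) :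
    evalMat k a (genericMatrix k n m h) = a h := by
  ext i j
  simp [evalMat, polyEval, genericMatrix]

lemma aux_eval_surj {n m : ℕ} (b : MTuple k n m) (hb : b ∈ genTuples k n m)
    (c : Matrix (Fin n) (Fin n) k) : ∃ x ∈ GMN k n m, evalMat k b x = c := by
  have h : (GMN k n m).map (evalMat k b) = ⊤ := by
    rw [GMN, AlgHom.map_adjoin, ← Set.range_comp]
    have : (evalMat k b ∘ genericMatrix k n m) = b := funext fun h => aux_evalMat_generic k b h
    rw [this]; exact hb
  have : c ∈ (GMN k n m).map (evalMat k b) := by rw [h]; trivial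
  exact this

lemma aux_evalMat_smul {n m : ℕ} (a : MTuple k n m) (φ : PolyRing k n m) (P : MatPoly k n m) :
    evalMat k a (φ • P) = polyEval k a φ • evalMat k a P := by
  ext i j; simp [evalMat]

lemma aux_trace_aeval_mem {K R : Type} [Field K] [CommRing R] [Algebra K R]
    {ι : Type} [Fintype ι] [DecidableEq ι] (S : Subalgebra K R)
    (G : Subalgebra K (Matrix ι ι R)) (hG : ∀ x ∈ G, x.trace ∈ S) (r : Matrix ι ι R) (hr : r ∈ G)
    (P : Polynomial S) :
    (Polynomial.aeval r (P.map (S.val : S →+* R))).trace ∈ S := by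
  induction P using Polynomial.induction_on' with
  | add p q hp hq =>
    rw [Polynomial.map_add, map_add, trace_add]; exact S.add_mem hp hq
  | monomial d c =>
    rw [Polynomial.map_monomial, Polynomial.aeval_monomial, Algebra.algebraMap_eq_smul_one,
      smul_mul_assoc, one_mul, trace_smul]
    exact S.mul_mem c.2 (hG _ (G.pow_mem hr d))

lemma aux_trace_aeval_map {K R : Type} [CommRing K] [CommRing R] (ψ : R →+* K)
    {ι : Type} [Fintype ι] [DecidableEq ι] (r : Matrix ι ι R) (P : Polynomial R) :
    ψ (Polynomial.aeval r P).trace = (Polynomial.aeval (ψ.mapMatrix r) (P.map ψ)).trace := by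
  induction P using Polynomial.induction_on' with
  | add p q hp hq =>
    rw [Polynomial.map_add, map_add, trace_add, map_add, map_add, trace_add, hp, hq]
  | monomial d c =>
    rw [Polynomial.map_monomial, Polynomial.aeval_monomial, Algebra.algebraMap_eq_smul_one,
      smul_mul_assoc, one_mul, trace_smul, Polynomial.aeval_monomial,
      Algebra.algebraMap_eq_smul_one, smul_mul_assoc, one_mul, trace_smul, smul_eq_mul, map_mul,
      smul_eq_mul, ← map_pow]
    congr 1
    simp [trace]

/-- Evaluation of the trace against the adjugate of the characteristic matrix. -/
lemma aux_eval_trace_adj {K R : Type} [CommRing K] [CommRing R] (ψ : R →+* K)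
    {ι : Type} [Fintype ι] [DecidableEq ι] (x r : Matrix ι ι R) (l : K) :
    Polynomial.eval l (Polynomial.map ψ (x.map Polynomial.C * adjugate (charmatrix r)).trace)
      = (ψ.mapMatrix x * adjugate (Matrix.scalar ι l - ψ.mapMatrix r)).trace := by
  set θ : Polynomial R →+* K := (Polynomial.evalRingHom l).comp (Polynomial.mapRingHom ψ) with hθ
  have h0 : ∀ M : Matrix ι ι (Polynomial R), θ M.trace = (θ.mapMatrix M).trace := by
    intro M; simp [trace]
  change θ _ = _
  rw [h0, map_mul, RingHom.map_adjugate]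
  have h1 : θ.mapMatrix (x.map Polynomial.C) = ψ.mapMatrix x := by
    ext i j; simp [hθ]
  have h2 : θ.mapMatrix (charmatrix r) = Matrix.scalar ι l - ψ.mapMatrix r := by
    ext i j
    by_cases hij : i = j
    · subst hij; simp [hθ, charmatrix]
    · simp [hθ, charmatrix, hij]
  rw [h1, h2]

/-- The pointwise vanishing statement. -/
lemma aux_point {n m : ℕ} (a : MTuple k n m) (f : PolyRing k n m)
    (hf : ∀ g : GL (Fin n) k, polyEval k (conjAct k g a) f = 0)
    (W W' : Fin n → Matrix (Fin n) (Fin n) k) (v u : Fin n → k)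
    (K : Matrix (Fin n) (Fin n) k) (B : Fin m → Matrix (Fin n) (Fin n) k)
    (hK : ∀ i j, K i j = (W' i * W j * vecMulVec v u).trace)
    (hB : ∀ h i j, B h i j = (W' i * a h * W j * vecMulVec v u).trace) :
    auxHom f K.det (fun s : MIdx n m => (adjugate K * B s.1) s.2.1 s.2.2) = 0 := by
  set g : Matrix (Fin n) (Fin n) k := Matrix.of fun i j => (W j *ᵥ v) i with hg
  set g' : Matrix (Fin n) (Fin n) k := Matrix.of fun i j => (u ᵥ* W' i) j with hg'
  have htr : ∀ M : Matrix (Fin n) (Fin n) k, (M * vecMulVec v u).trace = u ⬝ᵥ (M *ᵥ v) := by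
    intro M
    rw [mul_vecMulVec, trace_vecMulVec, dotProduct_comm]
  have hKg : K = g' * g := by
    ext i j
    rw [hK, htr, ← mulVec_mulVec, dotProduct_mulVec]
    rfl
  have hBg : ∀ h, B h = g' * (a h * g) := by
    intro h
    ext i j
    rw [hB, htr, ← mulVec_mulVec, ← mulVec_mulVec, dotProduct_mulVec, mul_apply]
    simp only [dotProduct]
    refine Finset.sum_congr rfl fun l _ => ?_
    rfl
  by_cases hd : K.det = 0
  · rw [hd]; exact auxHom_zero _ _
  have hd' := hd
  rw [hKg, det_mul] at hd'
  have hgd : g.det ≠ 0 := right_ne_zero_of_mul hd'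
  have hgd' : g'.det ≠ 0 := left_ne_zero_of_mul hd'
  let γ : GL (Fin n) k := (Matrix.GeneralLinearGroup.mkOfDetNeZero g hgd)⁻¹
  have hγ : (γ : Matrix (Fin n) (Fin n) k) = g⁻¹ := by
    simp [γ, Matrix.coe_units_inv, Matrix.GeneralLinearGroup.mkOfDetNeZero]
  have hγ' : ((γ⁻¹ : GL (Fin n) k) : Matrix (Fin n) (Fin n) k) = g := by
    simp [γ, Matrix.GeneralLinearGroup.mkOfDetNeZero]
  have hadj : ∀ h, adjugate K * B h = K.det • conjAct k γ a h := by
    intro h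
    rw [conjAct, hγ, hγ', hBg, hKg, adjugate_mul_distrib, Matrix.mul_assoc,
      ← Matrix.mul_assoc (adjugate g'), adjugate_mul, smul_mul_assoc, one_mul, mul_smul_comm,
      det_mul, Matrix.inv_def, Ring.inverse_eq_inv', smul_mul_assoc, smul_mul_assoc, smul_smul,
      mul_assoc, mul_inv_cancel₀ hgd, mul_one, mul_assoc]
  have : (fun s : MIdx n m => (adjugate K * B s.1) s.2.1 s.2.2)
      = fun s => K.det * conjAct k γ a s.1 s.2.1 s.2.2 := by
    funext s; rw [hadj]; rfl
  rw [this, auxHom_smul]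
  have h2 := hf γ
  rw [polyEval] at h2
  rw [h2, mul_zero]

lemma auxHom_map_mat {k R R' : Type} {n m : ℕ} [Field k] [CommRing R] [Algebra k R]
    [CommRing R'] [Algebra k R'] (φ : R →ₐ[k] R') (f : MvPolynomial (MIdx n m) k)
    (K : Matrix (Fin n) (Fin n) R) (B : Fin m → Matrix (Fin n) (Fin n) R) :
    φ (auxHom f K.det (fun s : MIdx n m => (adjugate K * B s.1) s.2.1 s.2.2))
      = auxHom f (φ.mapMatrix K).det (fun s : MIdx n m =>
        (adjugate (φ.mapMatrix K) * φ.mapMatrix (B s.1)) s.2.1 s.2.2) := by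
  rw [auxHom_map, AlgHom.map_det]
  congr 1
  funext s
  rw [← AlgHom.map_adjugate, ← map_mul]
  rfl

lemma aux_sep {n m : ℕ} (hn : 1 ≤ n) (Y : Set (MTuple k n m)) (f : PolyRing k n m)
    (hf : ∀ a ∈ Y, ∀ g : GL (Fin n) k, polyEval k (conjAct k g a) f = 0)
    (b : MTuple k n m) (hb : b ∈ genTuples k n m) (hfb : polyEval k b f ≠ 0) :
    ∃ p ∈ GMN k n m, (∀ a ∈ Y, evalMat k a p = 0) ∧ evalMat k b p ≠ 0 := by
  have hne : Nonempty (Fin n) := ⟨⟨0, hn⟩⟩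
  obtain ⟨o⟩ := id hne
  choose z hzG hz using aux_eval_surj k b hb
  set G := GMN k n m with hGdef
  set S := auxS G with hS
  have hGS : ∀ x ∈ G, x.trace ∈ S := fun x hx => auxS_trace G x hx
  set r := z (Matrix.single o o 1) with hr
  have hrG : r ∈ G := hzG _
  set w := fun j => z (Matrix.single j o 1) with hw
  set w' := fun i => z (Matrix.single o i 1) with hw'
  have hXG : ∀ h, genericMatrix k n m h ∈ G := fun h => Algebra.subset_adjoin ⟨h, rfl⟩
  have hlift : ∀ x : G, ∃ q : Polynomial S, q.map (S.val : S →+* PolyRing k n m)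
      = ((x : MatPoly k n m).map Polynomial.C * adjugate (charmatrix r)).trace := by
    intro x
    have : ((x : MatPoly k n m).map Polynomial.C * adjugate (charmatrix r)).trace
        ∈ Polynomial.lifts (S.val : S →+* PolyRing k n m) := by
      rw [Polynomial.lifts_iff_coeff_lifts]
      intro j
      exact ⟨⟨_, aux_newton S G hGS r hrG x x.2 j⟩, rfl⟩
    rwa [Polynomial.mem_lifts] at this
  choose L hL using hlift
  set K : Matrix (Fin n) (Fin n) (Polynomial S) := Matrix.of fun i j =>
    L ⟨w' i * w j, G.mul_mem (hzG _) (hzG _)⟩ with hK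
  set B : Fin m → Matrix (Fin n) (Fin n) (Polynomial S) := fun h => Matrix.of fun i j =>
    L ⟨w' i * genericMatrix k n m h * w j, G.mul_mem (G.mul_mem (hzG _) (hXG h)) (hzG _)⟩ with hB
  set Ψ : Polynomial S := auxHom f K.det
    (fun s : MIdx n m => (adjugate K * B s.1) s.2.1 s.2.2) with hΨ
  set t : PolyRing k n m :=
    (Polynomial.aeval r ((Polynomial.X * Ψ).map (S.val : S →+* PolyRing k n m))).trace with ht
  have htS : t ∈ S := aux_trace_aeval_mem S G hGS r hrG _
  -- evaluation of `t`
  have htev : ∀ a, polyEval k a t = (Polynomial.aeval (evalMat k a r) (Polynomial.X *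
      Ψ.map ((polyEval k a : PolyRing k n m →+* k).comp (S.val : S →+* PolyRing k n m)))).trace := by
    intro a
    have := aux_trace_aeval_map (polyEval k a : PolyRing k n m →+* k) r
      ((Polynomial.X * Ψ).map (S.val : S →+* PolyRing k n m))
    rw [Polynomial.map_map] at this
    refine this.trans ?_
    rw [Polynomial.map_mul, Polynomial.map_X]
    rfl
  have hΨev : ∀ a l, Polynomial.eval l (Ψ.map ((polyEval k a : PolyRing k n m →+* k).comp
      (S.val : S →+* PolyRing k n m)))
      = auxHom f (Matrix.of fun i j => (evalMat k a (w' i) * evalMat k a (w j) *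
          adjugate (Matrix.scalar (Fin n) l - evalMat k a r)).trace).det
        (fun s : MIdx n m => (adjugate (Matrix.of fun i j => (evalMat k a (w' i) *
          evalMat k a (w j) * adjugate (Matrix.scalar (Fin n) l - evalMat k a r)).trace) *
          (Matrix.of fun i j => (evalMat k a (w' i) * a s.1 * evalMat k a (w j) *
          adjugate (Matrix.scalar (Fin n) l - evalMat k a r)).trace)) s.2.1 s.2.2) := by
    intro a l
    let φ : Polynomial S →ₐ[k] k :=
      ((Polynomial.aeval l : Polynomial k →ₐ[k] k)).comp
        (Polynomial.mapAlgHom ((polyEval k a).comp S.val))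
    have hφ : ∀ q, φ q = Polynomial.eval l (q.map ((polyEval k a : PolyRing k n m →+* k).comp
      (S.val : S →+* PolyRing k n m))) := by
      intro q
      simp only [φ, AlgHom.comp_apply, Polynomial.coe_aeval_eq_eval]
      rfl
    have hφL : ∀ x : G, φ (L x) = (evalMat k a (x : MatPoly k n m) *
        adjugate (Matrix.scalar (Fin n) l - evalMat k a r)).trace := by
      intro x
      rw [hφ, ← Polynomial.map_map, hL, aux_eval_trace_adj]
      rfl
    have hφK : φ.mapMatrix K = (Matrix.of fun i j => (evalMat k a (w' i) * evalMat k a (w j) *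
          adjugate (Matrix.scalar (Fin n) l - evalMat k a r)).trace) := by
      ext i j
      rw [AlgHom.mapMatrix_apply, Matrix.map_apply, hK, Matrix.of_apply, hφL, Matrix.of_apply,
        map_mul]
    have hφB : ∀ h, φ.mapMatrix (B h) = (Matrix.of fun i j => (evalMat k a (w' i) * a h *
          evalMat k a (w j) *
          adjugate (Matrix.scalar (Fin n) l - evalMat k a r)).trace) := by
      intro h
      ext i j
      have h7 : φ.mapMatrix (B h) i j = φ (L ⟨w' i * genericMatrix k n m h * w j,
        G.mul_mem (G.mul_mem (hzG _) (hXG h)) (hzG _)⟩) := rfl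
      rw [h7, hφL, map_mul, map_mul, aux_evalMat_generic]
      rfl
    rw [← hφ]
    refine (auxHom_map_mat φ f K B).trans ?_
    simp only [hφK, hφB]
  have htY : ∀ a ∈ Y, polyEval k a t = 0 := by
    intro a ha
    rw [htev]
    apply aux_trace_aeval_zero
    intro l hl
    obtain ⟨v, u, hvu⟩ := aux_adj_rank_one _ hl
    rw [Polynomial.eval_mul, hΨev, hvu]
    refine mul_eq_zero_of_right _ ?_
    exact aux_point k a f (hf a ha) (fun j => evalMat k a (w j)) (fun i => evalMat k a (w' i)) v u
      (Matrix.of fun i j => (evalMat k a (w' i) * evalMat k a (w j) * vecMulVec v u).trace)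
      (fun h => Matrix.of fun i j => (evalMat k a (w' i) * a h * evalMat k a (w j) *
          vecMulVec v u).trace) (fun i j => rfl) (fun h i j => rfl)
  have htb : polyEval k b t ≠ 0 := by
    rw [htev, map_mul, Polynomial.aeval_X, hr, hz, aux_idem _ (by simp), trace_smul,
      trace_single_eq_same, smul_eq_mul, mul_one, hΨev]
    have hE : adjugate (Matrix.scalar (Fin n) 1 - evalMat k b r) = Matrix.single o o (1:k) := by
      have : Matrix.scalar (Fin n) 1 - evalMat k b r
          = diagonal (fun i => if i = o then (0:k) else 1) := by
        rw [hr, hz]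
        ext i j
        by_cases hij : i = j
        · subst hij
          by_cases hio : i = o
          · subst hio; simp
          · simp [hio, Ne.symm hio, Matrix.single_apply]
        · have : ¬ (o = i ∧ o = j) := fun h => hij (h.1.symm.trans h.2)
          simp [hij, Matrix.single_apply, this]
      rw [this, adjugate_diagonal]
      ext i j
      by_cases hij : i = j
      · subst hij
        by_cases hio : i = o
        · subst hio
          simp only [diagonal_apply_eq, single_apply_same]
          refine Finset.prod_eq_one fun x hx => ?_
          rw [if_neg (Finset.ne_of_mem_erase hx)]
        · rw [diagonal_apply_eq, Matrix.single_apply, if_neg (fun h => hio h.1.symm)]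
          exact Finset.prod_eq_zero (Finset.mem_erase.2 ⟨Ne.symm hio, Finset.mem_univ o⟩) (by simp)
      · have : ¬ (o = i ∧ o = j) := fun h => hij (h.1.symm.trans h.2)
        simp [hij, Matrix.single_apply, this]
    have hK1 : (Matrix.of fun i j => (evalMat k b (w' i) * evalMat k b (w j) *
          adjugate (Matrix.scalar (Fin n) 1 - evalMat k b r)).trace) = 1 := by
      ext i j
      rw [hE]
      simp only [hw, hw', hz, Matrix.of_apply]
      by_cases hij : i = j
      · subst hij; simp
      · simp [hij]
    have hB1 : ∀ h, (Matrix.of fun i j => (evalMat k b (w' i) * b h * evalMat k b (w j) *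
          adjugate (Matrix.scalar (Fin n) 1 - evalMat k b r)).trace) = b h := by
      intro h
      ext i j
      rw [hE]
      simp only [hw, hw', hz, Matrix.of_apply]
      rw [Matrix.single_mul_mul_single]
      simp
    rw [hK1]
    simp only [hB1]
    have := auxHom_smul f (1:k) (fun s : MIdx n m => b s.1 s.2.1 s.2.2)
    simp only [one_mul, one_pow] at this
    rw [adjugate_one, det_one]
    simp only [one_mul]
    rw [this]
    exact hfb
  obtain ⟨P, hP0, hP⟩ := aux_capelli G (polyEval k b) o (fun c => ⟨z c, hzG c, hz c⟩)
  set y : Fin n × Fin n → MatPoly k n m := fun s => z (Matrix.single s.1 s.2 1) with hy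
  refine ⟨(t * (auxD y).det) • P,
    hP _ (htS _ (Submodule.subset_span ⟨y, fun s => hzG _, rfl⟩)), ?_, ?_⟩
  · intro a ha
    rw [aux_evalMat_smul, map_mul, htY a ha, zero_mul, zero_smul]
  · rw [aux_evalMat_smul, map_mul]
    have hD : polyEval k b (auxD y).det = 1 := by
      rw [AlgHom.map_det]
      have : (polyEval k b).mapMatrix (auxD y) = 1 := by
        ext s p
        have h6 : (polyEval k b).mapMatrix (auxD y) s p = evalMat k b (y s) p.1 p.2 := rfl
        rw [h6, hy]
        simp only [hz]
        by_cases hsp : s = p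
        · subst hsp; simp
        · have : ¬ (s.1 = p.1 ∧ s.2 = p.2) := fun h => hsp (Prod.ext h.1 h.2)
          simp [hsp, Matrix.single_apply, this]
      rw [this, det_one]
    rw [hD, mul_one]
    exact smul_ne_zero htb hP0

end Sep

section Final
open Matrix

lemma aux_gl_point {n m : ℕ} (a : MTuple k n m) (f : PolyRing k n m) (γ : GL (Fin n) k)
    (N : Matrix (Fin n) (Fin n) k) (hN : (γ : Matrix (Fin n) (Fin n) k) = N) :
    auxHom f N.det (fun s : MIdx n m => (N * a s.1 * adjugate N) s.2.1 s.2.2)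
      = N.det ^ (f.totalDegree + 1) * polyEval k (conjAct k γ a) f := by
  have hd : N.det ≠ 0 := by
    rw [← hN]
    exact ((Matrix.isUnit_iff_isUnit_det _).1 γ.isUnit).ne_zero
  have : (fun s : MIdx n m => (N * a s.1 * adjugate N) s.2.1 s.2.2)
      = fun s => N.det * conjAct k γ a s.1 s.2.1 s.2.2 := by
    funext s
    have : N * a s.1 * adjugate N = N.det • conjAct k γ a s.1 := by
      rw [conjAct, Matrix.coe_units_inv, hN, Matrix.inv_def, Ring.inverse_eq_inv', mul_smul_comm,
        smul_smul, mul_inv_cancel₀ hd, one_smul]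
    rw [this]; rfl
  rw [this, auxHom_smul]
  rfl

lemma auxHom_map_conj {k R R' : Type} {n m : ℕ} [Field k] [CommRing R] [Algebra k R]
    [CommRing R'] [Algebra k R'] (φ : R →ₐ[k] R') (f : MvPolynomial (MIdx n m) k)
    (K : Matrix (Fin n) (Fin n) R) (B : Fin m → Matrix (Fin n) (Fin n) R) :
    φ (auxHom f K.det (fun s : MIdx n m => (K * B s.1 * adjugate K) s.2.1 s.2.2))
      = auxHom f (φ.mapMatrix K).det (fun s : MIdx n m =>
        (φ.mapMatrix K * φ.mapMatrix (B s.1) * adjugate (φ.mapMatrix K)) s.2.1 s.2.2) := by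
  rw [auxHom_map, AlgHom.map_det]
  congr 1
  funext s
  rw [← AlgHom.map_adjugate, ← map_mul, ← map_mul]
  rfl

lemma aux_gl {n m : ℕ} (a : MTuple k n m) (f₁ f₂ : PolyRing k n m)
    (h : ∀ g, polyEval k (conjAct k g a) f₁ = 0 ∨ polyEval k (conjAct k g a) f₂ = 0) :
    (∀ g, polyEval k (conjAct k g a) f₁ = 0) ∨ (∀ g, polyEval k (conjAct k g a) f₂ = 0) := by
  by_contra hcon
  push Not at hcon
  obtain ⟨⟨g₁, h₁⟩, g₂, h₂⟩ := hcon
  let M : Matrix (Fin n) (Fin n) (Polynomial k) := Matrix.of fun i j =>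
    Polynomial.C (g₁.1 i j) + Polynomial.X * Polynomial.C (g₂.1 i j - g₁.1 i j)
  let B : Fin m → Matrix (Fin n) (Fin n) (Polynomial k) := fun h => (a h).map Polynomial.C
  let H : PolyRing k n m → Polynomial k := fun f =>
    auxHom f M.det (fun s : MIdx n m => (M * B s.1 * adjugate M) s.2.1 s.2.2)
  let ev : k → Polynomial k →ₐ[k] k := fun s => Polynomial.aeval s
  let N : k → Matrix (Fin n) (Fin n) k := fun s => Matrix.of fun i j =>
    g₁.1 i j + s * (g₂.1 i j - g₁.1 i j)
  have hM : ∀ s, (ev s).mapMatrix M = N s := by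
    intro s
    ext i j
    have : (ev s).mapMatrix M i j = ev s (Polynomial.C (g₁.1 i j) +
      Polynomial.X * Polynomial.C (g₂.1 i j - g₁.1 i j)) := rfl
    rw [this]
    simp [ev, N]
  have hB : ∀ s h, (ev s).mapMatrix (B h) = a h := by
    intro s h
    ext i j
    have : (ev s).mapMatrix (B h) i j = ev s (Polynomial.C (a h i j)) := rfl
    rw [this]
    simp [ev]
  have hH : ∀ s f, ev s (H f)
      = auxHom f (N s).det (fun t : MIdx n m => (N s * a t.1 * adjugate (N s)) t.2.1 t.2.2) := by
    intro s f
    refine (auxHom_map_conj (ev s) f M B).trans ?_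
    simp only [hM, hB]
  have hdet : ∀ s, ev s M.det = (N s).det := by
    intro s
    rw [AlgHom.map_det, hM]
  have hN0 : (g₁ : Matrix (Fin n) (Fin n) k) = N 0 := by
    ext i j; simp [N]
  have hN1 : (g₂ : Matrix (Fin n) (Fin n) k) = N 1 := by
    ext i j; simp [N]
  have hd0 : (N 0).det ≠ 0 := by
    rw [← hN0]
    exact ((Matrix.isUnit_iff_isUnit_det _).1 g₁.isUnit).ne_zero
  have hd1 : (N 1).det ≠ 0 := by
    rw [← hN1]
    exact ((Matrix.isUnit_iff_isUnit_det _).1 g₂.isUnit).ne_zero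
  have hp : M.det * (H f₁ * H f₂) ≠ 0 := by
    refine mul_ne_zero ?_ (mul_ne_zero ?_ ?_)
    · intro h0
      apply hd0
      rw [← hdet, h0, map_zero]
    · intro h0
      have h3 := hH 0 f₁
      rw [h0, map_zero, aux_gl_point k a f₁ g₁ _ hN0] at h3
      exact mul_ne_zero (pow_ne_zero _ hd0) h₁ h3.symm
    · intro h0
      have h3 := hH 1 f₂
      rw [h0, map_zero, aux_gl_point k a f₂ g₂ _ hN1] at h3
      exact mul_ne_zero (pow_ne_zero _ hd1) h₂ h3.symm
  apply hp
  apply Polynomial.funext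
  intro s
  rw [Polynomial.eval_zero]
  have : Polynomial.eval s (M.det * (H f₁ * H f₂)) = ev s (M.det * (H f₁ * H f₂)) := by
    simp only [ev, Polynomial.coe_aeval_eq_eval]
  rw [this, map_mul, map_mul, hdet]
  by_cases hd : (N s).det = 0
  · rw [hd, zero_mul]
  let γ : GL (Fin n) k := Matrix.GeneralLinearGroup.mkOfDetNeZero (N s) hd
  rw [hH, hH, aux_gl_point k a f₁ γ (N s) rfl, aux_gl_point k a f₂ γ (N s) rfl]
  rcases h γ with h0 | h0 <;> rw [h0] <;> simp

/-- The pointwise form of primeness. -/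
def auxPW {n m : ℕ} (A : Subalgebra k (MatPoly k n m)) (X : Set (MTuple k n m)) : Prop :=
  ∀ p ∈ A, ∀ q ∈ A, (∀ a ∈ X, evalMat k a p = 0 ∨ evalMat k a q = 0) →
    (∀ a ∈ X, evalMat k a p = 0) ∨ (∀ a ∈ X, evalMat k a q = 0)

lemma aux_matrix_prime {n : ℕ} (p q : Matrix (Fin n) (Fin n) k)
    (h : ∀ c, p * c * q = 0) : p = 0 ∨ q = 0 := by
  by_contra hcon
  push Not at hcon
  obtain ⟨hp, hq⟩ := hcon
  apply hp
  ext i j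
  by_contra hij
  apply hq
  ext s t
  have h1 := congrFun (congrFun (h (Matrix.single j s 1)) i) t
  rw [Matrix.mul_assoc, Matrix.mul_apply, Finset.sum_eq_single j] at h1
  · rw [Matrix.single_mul_apply_same] at h1
    rw [one_mul] at h1
    exact (mul_eq_zero.1 h1).resolve_left hij
  · intro b _ hb
    rw [Matrix.single_mul_apply_of_ne _ _ _ _ _ hb, mul_zero]
  · intro hj
    exact absurd (Finset.mem_univ j) hj

lemma aux_pw_of_mul {n m : ℕ} (A : Subalgebra k (MatPoly k n m)) (hA : GMN k n m ≤ A)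
    (X : Set (MTuple k n m)) (hX : X ⊆ genTuples k n m) (p q : MatPoly k n m)
    (h : ∀ x ∈ A, ∀ a ∈ X, evalMat k a (p * x * q) = 0) :
    ∀ a ∈ X, evalMat k a p = 0 ∨ evalMat k a q = 0 := by
  intro a ha
  apply aux_matrix_prime
  intro c
  obtain ⟨x, hx, rfl⟩ := aux_eval_surj k a (hX ha) c
  rw [← map_mul, ← map_mul]
  exact h x (hA hx) a ha

lemma aux_prime_iff {n m : ℕ} (hn : 1 ≤ n) {A : Subalgebra k (MatPoly k n m)}
    (hA : GMN k n m ≤ A) {X : Set (MTuple k n m)} (hX : X ⊆ genTuples k n m) (hne : X.Nonempty)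
    {R : Type} [Ring R] (π : ↥A →+* R) (hπ : Function.Surjective π)
    (hker : ∀ p : ↥A, π p = 0 ↔ ∀ a ∈ X, evalMat k a (p : MatPoly k n m) = 0) :
    IsPrimeRing R ↔ auxPW k A X := by
  constructor
  · rintro ⟨_, h⟩ p hp q hq hpq
    have := h (π ⟨p, hp⟩) (π ⟨q, hq⟩) ?_
    · rwa [hker, hker] at this
    · intro x
      obtain ⟨x, rfl⟩ := hπ x
      rw [← map_mul, ← map_mul, hker]
      intro a ha
      have h1 : ((⟨p, hp⟩ * x * ⟨q, hq⟩ : ↥A) : MatPoly k n m) = p * (x : MatPoly k n m) * q := rfl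
      rw [h1, map_mul, map_mul]
      rcases hpq a ha with h0 | h0 <;> rw [h0] <;> simp
  · intro h
    refine ⟨⟨1, 0, ?_⟩, ?_⟩
    · rw [← map_one π, ne_eq, hker]
      intro h1
      obtain ⟨a, ha⟩ := hne
      have h2 := h1 a ha
      have h3 : ((1 : ↥A) : MatPoly k n m) = 1 := rfl
      rw [h3, map_one] at h2
      have h4 := congrFun (congrFun h2 ⟨0, hn⟩) ⟨0, hn⟩
      simp at h4
    · intro p q hpq
      obtain ⟨p, rfl⟩ := hπ p
      obtain ⟨q, rfl⟩ := hπ q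
      rw [hker, hker]
      apply h p p.2 q q.2
      apply aux_pw_of_mul k A hA X hX
      intro x hx
      have := hpq (π ⟨x, hx⟩)
      rw [← map_mul, ← map_mul, hker] at this
      exact this

lemma aux_quot_iff {n m : ℕ} (hn : 1 ≤ n) (A : Subalgebra k (MatPoly k n m))
    (hA : GMN k n m ≤ A) (X : Set (MTuple k n m)) (hX : X ⊆ genTuples k n m) (hne : X.Nonempty) :
    IsPrimeRing (idealQuot (vanishIdeal k A X)) ↔ auxPW k A X := by
  refine aux_prime_iff k hn hA hX hne ((vanishIdeal k A X).ringCon.mk') ?_ ?_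
  · exact Quotient.mk''_surjective
  · intro p
    have h1 : (vanishIdeal k A X).ringCon.mk' p = 0 ↔ p ∈ vanishIdeal k A X := by
      rw [TwoSidedIdeal.mem_iff, ← map_zero ((vanishIdeal k A X).ringCon.mk')]
      exact RingCon.eq _
    rw [h1, vanishIdeal, TwoSidedIdeal.mem_mk']
    rfl

lemma aux_coord_iff {n m : ℕ} (hn : 1 ≤ n) (X : Set (MTuple k n m))
    (hX : X ⊆ genTuples k n m) (hne : X.Nonempty) :
    IsPrimeRing ↥(coordRing k X) ↔ auxPW k (GMN k n m) X := by
  let π : ↥(GMN k n m) →+* ↥(coordRing k X) :=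
    { toFun := fun p => ⟨restrictTo k X p, p, p.2, rfl⟩
      map_one' := Subtype.ext (map_one (restrictTo k X))
      map_zero' := Subtype.ext (map_zero (restrictTo k X))
      map_mul' := fun p q => Subtype.ext (map_mul (restrictTo k X) _ _)
      map_add' := fun p q => Subtype.ext (map_add (restrictTo k X) _ _) }
  refine aux_prime_iff k hn le_rfl hX hne π ?_ ?_
  · rintro ⟨y, p, hp, rfl⟩
    exact ⟨⟨p, hp⟩, rfl⟩
  · intro p
    constructor
    · intro h a ha
      exact congrFun (congrArg Subtype.val h) ⟨a, ha⟩
    · intro h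
      apply Subtype.ext
      funext a
      exact h a.1 a.2

lemma aux_irred_pw {n m : ℕ} (A : Subalgebra k (MatPoly k n m)) (X : Set (MTuple k n m))
    (h : IsIrredSubset k X) : auxPW k A X := by
  have hZ : ∀ p : MatPoly k n m, IsZClosed k {a | evalMat k a p = 0} := by
    intro p
    refine ⟨Set.range fun s : Fin n × Fin n => p s.1 s.2, ?_⟩
    ext a
    constructor
    · rintro h _ ⟨s, rfl⟩
      exact congrFun (congrFun h s.1) s.2
    · intro h
      show evalMat k a p = 0
      ext i j
      exact h _ ⟨(i, j), rfl⟩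
  intro p _ q _ hpq
  exact h.2 _ _ (hZ p) (hZ q) hpq

lemma aux_pw_irred {n m : ℕ} (hn : 1 ≤ n) (X : Set (MTuple k n m)) (hX : IsNVariety k X)
    (hne : X.Nonempty) (h : auxPW k (GMN k n m) X) : IsIrredSubset k X := by
  refine ⟨hne, ?_⟩
  rintro C₁ C₂ ⟨S₁, rfl⟩ ⟨S₂, rfl⟩ hC
  by_contra hcon
  push Not at hcon
  obtain ⟨hc₁, hc₂⟩ := hcon
  obtain ⟨a₁, ha₁, hb₁⟩ := Set.not_subset.1 hc₁
  obtain ⟨a₂, ha₂, hb₂⟩ := Set.not_subset.1 hc₂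
  simp only [Set.mem_setOf_eq, not_forall] at hb₁ hb₂
  obtain ⟨f₁, hf₁, hn₁⟩ := hb₁
  obtain ⟨f₂, hf₂, hn₂⟩ := hb₂
  obtain ⟨p₁, hp₁, hv₁, hw₁⟩ := aux_sep k hn
    {a | ∀ g : GL (Fin n) k, polyEval k (conjAct k g a) f₁ = 0} f₁ (fun a ha => ha) a₁
    (hX.1 ha₁) hn₁
  obtain ⟨p₂, hp₂, hv₂, hw₂⟩ := aux_sep k hn
    {a | ∀ g : GL (Fin n) k, polyEval k (conjAct k g a) f₂ = 0} f₂ (fun a ha => ha) a₂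
    (hX.1 ha₂) hn₂
  have hpw : ∀ a ∈ X, evalMat k a p₁ = 0 ∨ evalMat k a p₂ = 0 := by
    intro a ha
    refine (aux_gl k a f₁ f₂ ?_).imp (hv₁ a) (hv₂ a)
    intro g
    exact (hC (hX.2.1 g a ha)).imp (fun h => h f₁ hf₁) (fun h => h f₂ hf₂)
  rcases h p₁ hp₁ p₂ hp₂ hpw with h1 | h1
  · exact hw₁ (h1 a₁ ha₁)
  · exact hw₂ (h1 a₂ ha₂)

end Final

/-- **Statement 7** (Lemma lem.irred).  Let `∅ ≠ X ⊆ U_{m,n}` be an `n`-variety.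
The following are equivalent:
(a) `X` is irreducible;
(b) `I_T(X)` is a prime ideal of `T_{m,n}` (i.e. `T_{m,n}/I_T(X)` is a prime ring);
(c) `I(X)` is a prime ideal of `G_{m,n}` (i.e. `G_{m,n}/I(X)` is a prime ring);
(d) `k_n[X]` is a prime ring. -/
theorem irreducible_tfae (n m : ℕ) (hn : 1 ≤ n) (hm : 2 ≤ m)
    (X : Set (MTuple k n m)) (hX : IsNVariety k X) (hne : X.Nonempty) :
    List.TFAE
      [IsIrredSubset k X,
       IsPrimeRing (idealQuot (vanishIdeal k (TMN k n m) X)),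
       IsPrimeRing (idealQuot (vanishIdeal k (GMN k n m) X)),
       IsPrimeRing ↥(coordRing k X)] := by
  have hG := aux_quot_iff k hn (GMN k n m) le_rfl X hX.1 hne
  have hT := aux_quot_iff k hn (TMN k n m) (GMN_le_TMN k n m) X hX.1 hne
  have hC := aux_coord_iff k hn X hX.1 hne
  rw [hG, hT, hC]
  tfae_have 1 → 2 := aux_irred_pw k _ X
  tfae_have 2 → 3 := fun h p hp q hq => h p (GMN_le_TMN k n m hp) q (GMN_le_TMN k n m hq)
  tfae_have 3 → 1 := aux_pw_irred k hn X hX hne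
  tfae_have 3 ↔ 4 := Iff.rfl
  tfae_finish

end
end

section
/- Let J ∈ Spec_n(T_{m,n}). Then: (a) Z(J) = Z(J ∩ C_{m,n}); and (b) Z(J) is irreducible. -/
set_option linter.unusedSectionVars false

noncomputable section

universe u

-- Throughout, `k` is an algebraically closed base field of characteristic zero.
variable (k : Type) [Field k] [IsAlgClosed k] [CharZero k]

/-- The set of scalar matrices with `PGL_n`-invariant polynomial entry, i.e. the
copy of `C_{m,n} = k[(M_n)^m]^{PGL_n}` inside `M_n(k[x_{ij}^{(h)}])` (it is the
center of `T_{m,n}`). -/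
def CMNscalar (n m : ℕ) : Set (MatPoly k n m) :=
  {q | ∃ f : PolyRing k n m,
    (∀ (g : GL (Fin n) k) (a : MTuple k n m), polyEval k (conjAct k g a) f = polyEval k a f) ∧
    q = algebraMap (PolyRing k n m) (MatPoly k n m) f}

section AuxA
open scoped TensorProduct

theorem aux_tensor_simple (K L Q : Type) [Field K] [Field L] [Algebra K L] [Ring Q] [Algebra K Q]
    [IsSimpleRing Q] (hc : (algebraMap K Q).range = Subring.center Q) :
    IsSimpleRing (L ⊗[K] Q) := by
  classical
  let bs := Module.Basis.ofVectorSpace K L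
  let e := TensorProduct.equivFinsuppOfBasisLeft (N := Q) bs
  have : Nontrivial (L ⊗[K] Q) := inferInstance
  have hel : ∀ (q : Q) (x : L ⊗[K] Q) i, e ((1 ⊗ₜ[K] q) * x) i = q * e x i := by
    intro q x i
    induction x with
    | zero => simp
    | tmul l r =>
      simp [e]
    | add x y hx hy => simp [mul_add, hx, hy]
  have her : ∀ (q : Q) (x : L ⊗[K] Q) i, e (x * (1 ⊗ₜ[K] q)) i = e x i * q := by
    intro q x i
    induction x with
    | zero => simp
    | tmul l r =>
      simp [e]
    | add x y hx hy => simp [add_mul, hx, hy]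
  refine IsSimpleRing.of_eq_bot_or_eq_top fun I => ?_
  by_cases hI : I = ⊥
  · exact Or.inl hI
  right
  have hex : ∃ d : ℕ, ∃ x ∈ I, x ≠ 0 ∧ (e x).support.card = d := by
    by_contra hcon
    push Not at hcon
    apply hI
    rw [eq_bot_iff]
    intro x hx
    by_contra hx0
    exact hcon _ x hx (by simpa [TwoSidedIdeal.mem_bot] using hx0) rfl
  obtain ⟨x, hxI, hx0, hxd⟩ := Nat.find_spec hex
  have hmin : ∀ y ∈ I, y ≠ 0 → (e x).support.card ≤ (e y).support.card := by
    intro y hy hy0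
    rw [hxd]
    exact Nat.find_min' hex ⟨y, hy, hy0, rfl⟩
  have hex0 : e x ≠ 0 := by simpa using hx0
  obtain ⟨i0, hi0⟩ := Finsupp.support_nonempty_iff.mpr hex0
  let D : TwoSidedIdeal Q := TwoSidedIdeal.mk'
    {q | ∃ y ∈ I, (e y).support ⊆ (e x).support ∧ e y i0 = q}
    ⟨0, I.zero_mem, by simp, by simp⟩
    (by
      rintro p q ⟨y, hy, hys, rfl⟩ ⟨z, hz, hzs, rfl⟩
      refine ⟨y + z, I.add_mem hy hz, ?_, by simp⟩
      rw [map_add]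
      exact Finsupp.support_add.trans (Finset.union_subset hys hzs))
    (by
      rintro p ⟨y, hy, hys, rfl⟩
      exact ⟨-y, I.neg_mem hy, by simpa using hys, by simp⟩)
    (by
      rintro p q ⟨y, hy, hys, rfl⟩
      refine ⟨(1 ⊗ₜ[K] p) * y, I.mul_mem_left _ _ hy, ?_, hel _ _ _⟩
      intro i hi
      apply hys
      rw [Finsupp.mem_support_iff] at hi ⊢
      intro h0
      exact hi (by rw [hel, h0, mul_zero]))
    (by
      rintro p q ⟨y, hy, hys, rfl⟩
      refine ⟨y * (1 ⊗ₜ[K] q), I.mul_mem_right _ _ hy, ?_, her _ _ _⟩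
      intro i hi
      apply hys
      rw [Finsupp.mem_support_iff] at hi ⊢
      intro h0
      exact hi (by rw [her, h0, zero_mul]))
  have h1 : (1 : Q) ∈ D := by
    apply IsSimpleRing.one_mem_of_ne_zero_mem D (x := e x i0) (by simpa using hi0)
    rw [TwoSidedIdeal.mem_mk']
    exact ⟨x, hxI, subset_rfl, rfl⟩
  rw [TwoSidedIdeal.mem_mk'] at h1
  obtain ⟨y, hyI, hys, hy1⟩ := h1
  have hcomm : ∀ q : Q, (1 ⊗ₜ[K] q) * y - y * (1 ⊗ₜ[K] q) = 0 := by
    intro q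
    by_contra hne
    have hle := hmin _ (I.sub_mem (I.mul_mem_left _ _ hyI) (I.mul_mem_right _ _ hyI)) hne
    have hss : (e ((1 ⊗ₜ[K] q) * y - y * (1 ⊗ₜ[K] q))).support ⊂ (e x).support := by
      rw [Finset.ssubset_iff_of_subset]
      · exact ⟨i0, hi0, by simp [hel, her, hy1]⟩
      · intro i hi
        apply hys
        rw [Finsupp.mem_support_iff] at hi ⊢
        intro h0
        exact hi (by simp [hel, her, h0])
    exact absurd (Finset.card_lt_card hss) (not_lt.mpr hle)
  have hcen : ∀ i, ∃ c : K, algebraMap K Q c = e y i := by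
    intro i
    have : e y i ∈ Subring.center Q := by
      rw [Subring.mem_center_iff]
      intro q
      have := congrArg (fun z => e z i) (hcomm q)
      simpa [hel, her, sub_eq_zero] using this
    rwa [← hc] at this
  choose c hcc using hcen
  obtain ⟨l, hl⟩ : ∃ l : L, y = l ⊗ₜ[K] (1 : Q) := by
    refine ⟨(e y).sum fun i _ => c i • bs i, ?_⟩
    have : y = e.symm (e y) := by simp
    refine this.trans ?_
    rw [TensorProduct.equivFinsuppOfBasisLeft_symm_apply]
    rw [Finsupp.sum, Finsupp.sum, TensorProduct.sum_tmul]
    refine Finset.sum_congr rfl fun i _ => ?_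
    rw [← hcc i, TensorProduct.smul_tmul, Algebra.smul_def, mul_one]
  have hl0 : l ≠ 0 := by
    rintro rfl
    have : Nontrivial Q := inferInstance
    simp [hl] at hy1
  have : (1 : L ⊗[K] Q) = (l⁻¹ ⊗ₜ[K] 1) * y := by
    rw [hl, Algebra.TensorProduct.tmul_mul_tmul, inv_mul_cancel₀ hl0, one_mul]; rfl
  rw [← TwoSidedIdeal.one_mem_iff, this]
  exact I.mul_mem_left _ _ hyI

theorem aux_split (n : ℕ) (hn : 1 ≤ n) (Q : Type) [Ring Q] (h : IsCSAOfDegree n Q) :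
    ∃ (L : Type) (_ : Field L) (ψ : Q →+* Matrix (Fin n) (Fin n) L),
      Function.Injective ψ ∧ Submodule.span L (Set.range ψ) = ⊤ := by
  obtain ⟨hs, K, _, _, hc, hfr⟩ := h
  let L := AlgebraicClosure K
  have hsimp := aux_tensor_simple K L Q hc
  have hfin : Module.Finite K Q := by
    apply Module.finite_of_finrank_pos
    rw [hfr]; positivity
  obtain ⟨r, _, ⟨e⟩⟩ := IsSimpleRing.exists_algEquiv_matrix_of_isAlgClosed L (L ⊗[K] Q)
  have hdim : n ^ 2 = r ^ 2 := by
    have h1 := e.toLinearEquiv.finrank_eq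
    rw [Module.finrank_baseChange, hfr, Module.finrank_matrix] at h1
    simpa [pow_two] using h1
  have hnr : n = r := Nat.pow_left_injective (n := 2) (by norm_num) hdim
  subst hnr
  let i : Q →+* L ⊗[K] Q := (Algebra.TensorProduct.includeRight : Q →ₐ[K] L ⊗[K] Q).toRingHom
  refine ⟨L, inferInstance, (e : L ⊗[K] Q →+* _).comp i, RingHom.injective _, ?_⟩
  rw [eq_top_iff]
  rintro x -
  obtain ⟨y, rfl⟩ := e.surjective x
  induction y with
  | zero => simp
  | tmul l q =>
    have : l ⊗ₜ[K] q = l • ((1 : L) ⊗ₜ[K] q) := by simp [TensorProduct.smul_tmul']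
    rw [this, map_smul]
    exact Submodule.smul_mem _ _ (Submodule.subset_span ⟨q, rfl⟩)
  | add x y hx hy => rw [map_add]; exact Submodule.add_mem _ hx hy

theorem aux_scalar_of_comm {n : ℕ} (hn : 1 ≤ n) {L : Type} [Field L]
    (S : Set (Matrix (Fin n) (Fin n) L)) (hS : Submodule.span L S = ⊤)
    (x : Matrix (Fin n) (Fin n) L) (hx : ∀ s ∈ S, s * x = x * s) :
    ∃ l : L, x = algebraMap L _ l := by
  have hall : ∀ y : Matrix (Fin n) (Fin n) L, y * x = x * y := by
    intro y
    have hy : y ∈ Submodule.span L S := by rw [hS]; trivial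
    induction hy using Submodule.span_induction with
    | mem s hs => exact hx s hs
    | zero => simp
    | add y z _ _ h1 h2 => rw [add_mul, mul_add, h1, h2]
    | smul l y _ h1 => rw [smul_mul_assoc, mul_smul_comm, h1]
  have : x ∈ Subalgebra.center L (Matrix (Fin n) (Fin n) L) := by
    rw [Subalgebra.mem_center_iff]; exact hall
  rw [Algebra.IsCentral.center_eq_bot, Algebra.mem_bot] at this
  obtain ⟨l, hl⟩ := this
  exact ⟨l, hl.symm⟩

theorem aux_split_R (n : ℕ) (hn : 1 ≤ n) (R : Type) [Ring R] (h : HasPIDegree n R) :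
    ∃ (L : Type) (_ : Field L) (ψ : R →+* Matrix (Fin n) (Fin n) L),
      Function.Injective ψ ∧ Submodule.span L (Set.range ψ) = ⊤ := by
  obtain ⟨Q, _, f, hf, hu, hq, hQ⟩ := h
  obtain ⟨L, _, ψ, hψ, hspan⟩ := aux_split n hn Q hQ
  refine ⟨L, inferInstance, ψ.comp f, hψ.comp hf, ?_⟩
  have hcen : ∀ c ∈ Subring.center R, ∀ q : Q, q * f c = f c * q := by
    intro c hc q
    obtain ⟨r, c', hc', hc0, he⟩ := hq q
    have hun := hu c' hc' hc0
    rw [Subring.mem_center_iff] at hc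
    apply hun.mul_right_cancel
    rw [mul_assoc, ← map_mul, hc c' |>.symm, map_mul, ← mul_assoc, he, mul_assoc, he,
      ← map_mul, ← map_mul, hc]
  rw [← top_le_iff, ← hspan, Submodule.span_le]
  rintro _ ⟨q, rfl⟩
  obtain ⟨r, c, hc, hc0, he⟩ := hq q
  obtain ⟨l, hl⟩ := aux_scalar_of_comm hn _ hspan (ψ (f c)) (by
    rintro _ ⟨s, rfl⟩
    rw [← map_mul, ← map_mul, hcen c hc])
  have hl0 : l ≠ 0 := by
    rintro rfl
    have := (hu c hc hc0).map ψ
    rw [hl, map_zero] at this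
    have : Nonempty (Fin n) := ⟨⟨0, hn⟩⟩
    exact not_isUnit_zero ‹_›
  have h2 : ψ q = l⁻¹ • ψ (f r) := by
    rw [← he, map_mul, hl, ← Algebra.commutes, ← Algebra.smul_def, smul_smul,
      inv_mul_cancel₀ hl0, one_smul]
  rw [SetLike.mem_coe, h2]
  exact Submodule.smul_mem _ _ (Submodule.subset_span ⟨r, rfl⟩)
end AuxA

section AuxB

theorem aux_trace_alt {S M ι : Type*} [CommRing S] [AddCommGroup M] [Module S M] [Fintype ι]
    [DecidableEq ι] (e : Module.Basis ι S M) (f : M [⋀^ι]→ₗ[S] S) (A : M →ₗ[S] M) (v : ι → M) :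
    ∑ i, f (Function.update v i (A (v i))) = LinearMap.trace S M A * f v := by
  rw [f.eq_smul_basis_det e]
  simp only [AlternatingMap.smul_apply, smul_eq_mul, Module.Basis.det_apply]
  rw [← Finset.mul_sum, mul_left_comm]
  congr 1
  have h1 : ∀ i, (e.toMatrix (Function.update v i (A (v i)))).det =
      ((e.toMatrix v).adjugate * (LinearMap.toMatrix e e A * e.toMatrix v)) i i := by
    intro i
    rw [Module.Basis.toMatrix_update, ← Matrix.cramer_apply, Matrix.cramer_eq_adjugate_mulVec,
      ← LinearMap.toMatrix_mulVec_repr e e A]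
    rfl
  rw [Finset.sum_congr rfl fun i _ => h1 i]
  change Matrix.trace _ = _
  rw [Matrix.trace_mul_comm, mul_assoc, Matrix.mul_adjugate, Matrix.mul_smul, mul_one,
    Matrix.trace_smul, ← LinearMap.trace_eq_matrix_trace S e, smul_eq_mul, mul_comm]

theorem aux_trace_mulLeft {S : Type*} [CommRing S] {n : ℕ} (x : Matrix (Fin n) (Fin n) S) :
    LinearMap.trace S _ (LinearMap.mulLeft S x) = n * x.trace := by
  rw [LinearMap.trace_eq_matrix_trace S (Matrix.stdBasis S (Fin n) (Fin n)), Matrix.trace,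
    Fintype.sum_prod_type]
  have h : ∀ i j : Fin n, Matrix.diag (LinearMap.toMatrix (Matrix.stdBasis S (Fin n) (Fin n))
      (Matrix.stdBasis S (Fin n) (Fin n)) (LinearMap.mulLeft S x)) (i, j) = x i i := by
    intro i j
    rw [Matrix.diag_apply, LinearMap.toMatrix_apply, Matrix.stdBasis_eq_single,
      LinearMap.mulLeft_apply]
    simp [Matrix.stdBasis]
  simp only [h]
  simp [Matrix.trace, Finset.mul_sum]

/-- A Capelli-type expression. -/
def auxCap {R : Type*} [Ring R] {N : ℕ} (z w y : Fin N → R) : R :=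
  ∑ σ : Equiv.Perm (Fin N), Equiv.Perm.sign σ • (List.ofFn fun i => z i * y (σ i) * w i).prod

theorem aux_map_cap {R R' : Type*} [Ring R] [Ring R'] (φ : R →+* R') {N : ℕ} (z w y : Fin N → R) :
    φ (auxCap z w y) = auxCap (φ ∘ z) (φ ∘ w) (φ ∘ y) := by
  simp only [auxCap, map_sum]
  refine Finset.sum_congr rfl fun σ _ => ?_
  rw [Units.smul_def, Units.smul_def, map_zsmul, map_list_prod, List.map_ofFn]
  congr 3
  ext i
  simp

/-- The general alternating map. -/
def auxAlt (S : Type*) [CommRing S] {R : Type*} [Ring R] [Algebra S R] {N : ℕ}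
    (Θ : Fin N → (R →ₗ[S] R)) : R [⋀^Fin N]→ₗ[S] R :=
  MultilinearMap.alternatization
    ((MultilinearMap.mkPiAlgebraFin S N R).compLinearMap Θ)

theorem auxAlt_apply_s7 (S : Type*) [CommRing S] {R : Type*} [Ring R] [Algebra S R] {N : ℕ}
    (Θ : Fin N → (R →ₗ[S] R)) (y : Fin N → R) :
    auxAlt S Θ y = ∑ σ : Equiv.Perm (Fin N), Equiv.Perm.sign σ •
      (List.ofFn fun i => Θ i (y (σ i))).prod := by
  simp [auxAlt, MultilinearMap.alternatization_apply]

theorem auxCap_eq (S : Type*) [CommRing S] {R : Type*} [Ring R] [Algebra S R] {N : ℕ}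
    (z w y : Fin N → R) :
    auxCap z w y =
      auxAlt S (fun i => (LinearMap.mulRight S (w i)).comp (LinearMap.mulLeft S (z i))) y := by
  rw [auxAlt_apply_s7]; rfl

theorem aux_cap_trace {S : Type*} [CommRing S] {n : ℕ}
    (z w y : Fin (n * n) → Matrix (Fin n) (Fin n) S) (x : Matrix (Fin n) (Fin n) S) :
    ∑ i, auxCap z w (Function.update y i (x * y i)) = (n * x.trace) • auxCap z w y := by
  simp only [auxCap_eq S]
  ext s t
  have := aux_trace_alt ((Matrix.stdBasis S (Fin n) (Fin n)).reindex finProdFinEquiv)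
    ((Matrix.entryLinearMap S S s t).compAlternatingMap
      (auxAlt S (fun i => (LinearMap.mulRight S (w i)).comp (LinearMap.mulLeft S (z i)))))
    (LinearMap.mulLeft S x) y
  rw [aux_trace_mulLeft] at this
  rw [Matrix.sum_apply]
  exact this

theorem aux_cap_ne {L : Type} [Field L] {n : ℕ} (hn : 1 ≤ n) {T : Type} [Ring T]
    (φ : T →+* Matrix (Fin n) (Fin n) L) (hφ : Submodule.span L (Set.range φ) = ⊤) :
    ∃ z w y : Fin (n * n) → T, auxCap (φ ∘ z) (φ ∘ w) (φ ∘ y) ≠ 0 := by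
  classical
  by_contra hcon
  push Not at hcon
  have h1 : ∀ (z w : Fin (n * n) → T) (y : Fin (n * n) → Matrix (Fin n) (Fin n) L),
      auxCap (φ ∘ z) (φ ∘ w) y = 0 := by
    intro z w y
    rw [auxCap_eq L]
    have := MultilinearMap.ext_of_span_eq_top (R := L) (g := fun (_ : Fin (n * n)) => φ)
      (fun _ => hφ) (φ := (auxAlt L (fun i => (LinearMap.mulRight L ((φ ∘ w) i)).comp
        (LinearMap.mulLeft L ((φ ∘ z) i)))).toMultilinearMap) (φ' := 0) (by
        intro j
        have := hcon z w j
        rw [auxCap_eq L] at this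
        exact this)
    exact DFunLike.congr_fun this y
  have h2 : ∀ (z : Fin (n * n) → T) (w y : Fin (n * n) → Matrix (Fin n) (Fin n) L),
      auxCap (φ ∘ z) w y = 0 := by
    intro z w y
    let F : MultilinearMap L (fun _ : Fin (n * n) => Matrix (Fin n) (Fin n) L)
        (Matrix (Fin n) (Fin n) L) :=
      ∑ σ : Equiv.Perm (Fin (n * n)), Equiv.Perm.sign σ •
        ((MultilinearMap.mkPiAlgebraFin L (n * n) (Matrix (Fin n) (Fin n) L)).compLinearMap
          (fun i => LinearMap.mulLeft L (φ (z i) * y (σ i))))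
    have hF : ∀ v, F v = auxCap (φ ∘ z) v y := by
      intro v
      simp [F, auxCap, mul_assoc]
    have := MultilinearMap.ext_of_span_eq_top (R := L) (g := fun (_ : Fin (n * n)) => φ)
      (fun _ => hφ) (φ := F) (φ' := 0) (by
        intro j
        rw [hF]
        exact h1 z j y)
    rw [← hF, this]; rfl
  have h3 : ∀ (z w y : Fin (n * n) → Matrix (Fin n) (Fin n) L), auxCap z w y = 0 := by
    intro z w y
    let F : MultilinearMap L (fun _ : Fin (n * n) => Matrix (Fin n) (Fin n) L)
        (Matrix (Fin n) (Fin n) L) :=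
      ∑ σ : Equiv.Perm (Fin (n * n)), Equiv.Perm.sign σ •
        ((MultilinearMap.mkPiAlgebraFin L (n * n) (Matrix (Fin n) (Fin n) L)).compLinearMap
          (fun i => LinearMap.mulRight L (y (σ i) * w i)))
    have hF : ∀ v, F v = auxCap v w y := by
      intro v
      simp [F, auxCap, mul_assoc]
    have := MultilinearMap.ext_of_span_eq_top (R := L) (g := fun (_ : Fin (n * n)) => φ)
      (fun _ => hφ) (φ := F) (φ' := 0) (by
        intro j
        rw [hF]
        exact h2 j w y)
    rw [← hF, this]; rfl
  let o : Fin n := ⟨0, hn⟩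
  let e := (finProdFinEquiv (m := n) (n := n)).symm
  have h4 := h3 (fun i => Matrix.single o (e i).1 1) (fun i => Matrix.single (e i).2 o 1)
    (fun i => Matrix.single (e i).1 (e i).2 1)
  rw [auxCap, Finset.sum_eq_single 1] at h4
  · have : (List.ofFn fun i : Fin (n * n) => Matrix.single o (e i).1 (1 : L) *
        Matrix.single (e ((1 : Equiv.Perm (Fin (n * n))) i)).1
          (e ((1 : Equiv.Perm (Fin (n * n))) i)).2 1 * Matrix.single (e i).2 o 1) =
        List.replicate (n * n) (Matrix.single o o 1) := by
      rw [← List.ofFn_const]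
      congr 1
      ext1 i
      simp
    rw [this, List.prod_replicate, Equiv.Perm.sign_one, one_smul] at h4
    have hid : IsIdempotentElem (Matrix.single o o (1 : L)) := by
      simp [IsIdempotentElem]
    rw [hid.pow_eq (by positivity)] at h4
    have := congrFun (congrFun h4 o) o
    simp at this
  · intro σ _ hσ
    obtain ⟨i, hi⟩ : ∃ i, σ i ≠ i := by
      by_contra hc
      push Not at hc
      exact hσ (Equiv.ext hc)
    rw [List.prod_eq_zero, smul_zero]
    rw [List.mem_ofFn]
    refine ⟨i, ?_⟩
    have hne : e (σ i) ≠ e i := fun h => hi (e.injective h)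
    by_cases h5 : (e i).1 = (e (σ i)).1
    · have h6 : (e (σ i)).2 ≠ (e i).2 := fun h => hne (Prod.ext h5.symm h)
      rw [Matrix.mul_assoc, Matrix.single_mul_single_of_ne _ _ _ _ h6, mul_zero]
    · rw [Matrix.single_mul_single_of_ne _ _ _ _ h5, zero_mul]
  · simp

/-- Trace compatibility: a ring homomorphism from a subring of matrices over a commutative ring
to matrices over a field with spanning image respects those traces that lie in the subring. -/
theorem aux_trace_compat {L P : Type} [Field L] [CharZero L] [CommRing P] {n : ℕ} (hn : 1 ≤ n)
    {T : Type} [Ring T] (ι : T →+* Matrix (Fin n) (Fin n) P) (hι : Function.Injective ι)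
    (φ : T →+* Matrix (Fin n) (Fin n) L) (hφ : Submodule.span L (Set.range φ) = ⊤)
    (x t : T) (ht : ι t = algebraMap P _ (ι x).trace) (l : L)
    (hl : φ t = algebraMap L _ l) : l = (φ x).trace := by
  obtain ⟨z, w, y, hne⟩ := aux_cap_ne hn φ hφ
  have hT : ∑ i, auxCap z w (Function.update y i (x * y i)) = (n : T) * t * auxCap z w y := by
    apply hι
    rw [map_mul, map_mul, ht, aux_map_cap, map_sum]
    have := aux_cap_trace (ι ∘ z) (ι ∘ w) (ι ∘ y) (ι x)
    simp only [Algebra.smul_def, map_mul, map_natCast] at this ⊢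
    rw [← this]
    refine Finset.sum_congr rfl fun i _ => ?_
    rw [aux_map_cap, Function.comp_update, map_mul]; rfl
  have h1 := congrArg φ hT
  rw [map_mul, map_mul, hl, aux_map_cap, map_sum] at h1
  have h2 := aux_cap_trace (φ ∘ z) (φ ∘ w) (φ ∘ y) (φ x)
  have h3 : ∑ i, φ (auxCap z w (Function.update y i (x * y i))) =
      ∑ i, auxCap (φ ∘ z) (φ ∘ w) (Function.update (φ ∘ y) i (φ x * (φ ∘ y) i)) := by
    refine Finset.sum_congr rfl fun i _ => ?_
    rw [aux_map_cap, Function.comp_update, map_mul]; rfl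
  rw [h3, h2, map_natCast, ← map_natCast (algebraMap L (Matrix (Fin n) (Fin n) L)), ← map_mul,
    ← Algebra.smul_def] at h1
  have h4 := smul_left_injective L hne h1
  have : (n : L) ≠ 0 := by exact_mod_cast (by omega : n ≠ 0)
  exact (mul_left_cancel₀ this h4).symm
end AuxB

section AuxC

/-- Evaluation of a polynomial at a tuple over a `k`-algebra. -/
def auxP {n m : ℕ} {R : Type} [CommRing R] [Algebra k R] (b : Fin m → Matrix (Fin n) (Fin n) R) :
    PolyRing k n m →ₐ[k] R :=
  MvPolynomial.aeval fun x : MIdx n m => b x.1 x.2.1 x.2.2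

/-- Evaluation of a matrix over the polynomial ring at a tuple over a `k`-algebra. -/
def auxE {n m : ℕ} {R : Type} [CommRing R] [Algebra k R] (b : Fin m → Matrix (Fin n) (Fin n) R) :
    MatPoly k n m →ₐ[k] Matrix (Fin n) (Fin n) R :=
  (auxP k b).mapMatrix

section
variable {n m : ℕ} {R : Type} [CommRing R] [Algebra k R] (b : Fin m → Matrix (Fin n) (Fin n) R)

theorem auxE_apply (x : MatPoly k n m) (i j : Fin n) : auxE k b x i j = auxP k b (x i j) := rfl

theorem auxE_trace (x : MatPoly k n m) : (auxE k b x).trace = auxP k b x.trace := by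
  simp [Matrix.trace, auxE_apply]

theorem auxE_algebraMap (f : PolyRing k n m) :
    auxE k b (algebraMap _ _ f) = algebraMap R _ (auxP k b f) := by
  ext i j
  rw [auxE_apply, Matrix.algebraMap_matrix_apply, Matrix.algebraMap_matrix_apply]
  split_ifs <;> simp

theorem auxE_generic (h : Fin m) : auxE k b (genericMatrix k n m h) = b h := by
  ext i j
  simp [auxE_apply, genericMatrix, auxP]

theorem auxE_map {S : Type} [CommRing S] [Algebra k S] (σ : R →ₐ[k] S) (x : MatPoly k n m) :
    auxE k (fun h => (b h).map σ) x = (auxE k b x).map σ := by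
  ext i j
  rw [auxE_apply, Matrix.map_apply, auxE_apply, auxP, auxP, ← AlgHom.comp_apply,
    MvPolynomial.comp_aeval]
  rfl

theorem auxP_map {S : Type} [CommRing S] [Algebra k S] (σ : R →ₐ[k] S) (x : PolyRing k n m) :
    auxP k (fun h => (b h).map σ) x = σ (auxP k b x) := by
  rw [auxP, auxP, ← AlgHom.comp_apply, MvPolynomial.comp_aeval]
  rfl

theorem auxG_conj (u v : Matrix (Fin n) (Fin n) R) (huv : u * v = 1)
    (x : MatPoly k n m) (hx : x ∈ GMN k n m) :
    auxE k (fun h => u * b h * v) x = u * auxE k b x * v := by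
  have hvu : v * u = 1 := mul_eq_one_comm.mp huv
  induction hx using Algebra.adjoin_induction with
  | mem x hx =>
    obtain ⟨h, rfl⟩ := hx
    rw [auxE_generic, auxE_generic]
  | algebraMap r =>
    rw [AlgHom.commutes, AlgHom.commutes, ← Algebra.commutes, mul_assoc, huv, mul_one]
  | add x y _ _ hx hy => rw [map_add, map_add, hx, hy, mul_add, add_mul]
  | mul x y _ _ hx hy =>
    rw [map_mul, map_mul, hx, hy]
    calc u * auxE k b x * v * (u * auxE k b y * v)
        = u * auxE k b x * (v * u) * auxE k b y * v := by simp only [mul_assoc]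
      _ = _ := by rw [hvu]; simp only [mul_assoc, mul_one]

theorem auxT_conj (u v : Matrix (Fin n) (Fin n) R) (huv : u * v = 1)
    (x : MatPoly k n m) (hx : x ∈ TMN k n m) :
    auxE k (fun h => u * b h * v) x = u * auxE k b x * v := by
  have hvu : v * u = 1 := mul_eq_one_comm.mp huv
  induction hx using Algebra.adjoin_induction with
  | mem x hx =>
    rcases hx with hx | ⟨p, hp, rfl⟩
    · exact auxG_conj k b u v huv x hx
    · rw [traceScalar, auxE_algebraMap, auxE_algebraMap, ← auxE_trace, ← auxE_trace,
        auxG_conj k b u v huv p hp, Matrix.trace_mul_comm, ← mul_assoc, hvu, one_mul,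
        ← Algebra.commutes, mul_assoc, huv, mul_one]
  | algebraMap r =>
    rw [AlgHom.commutes, AlgHom.commutes, ← Algebra.commutes, mul_assoc, huv, mul_one]
  | add x y _ _ hx hy => rw [map_add, map_add, hx, hy, mul_add, add_mul]
  | mul x y _ _ hx hy =>
    rw [map_mul, map_mul, hx, hy]
    calc u * auxE k b x * v * (u * auxE k b y * v)
        = u * auxE k b x * (v * u) * auxE k b y * v := by simp only [mul_assoc]
      _ = _ := by rw [hvu]; simp only [mul_assoc, mul_one]

theorem auxT_mem_adjoin (x : MatPoly k n m) (hx : x ∈ TMN k n m) :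
    auxE k b x ∈ Algebra.adjoin R (Set.range b) := by
  have hG : ∀ x ∈ GMN k n m, auxE k b x ∈ Algebra.adjoin R (Set.range b) := by
    intro x hx
    induction hx using Algebra.adjoin_induction with
    | mem x hx =>
      obtain ⟨h, rfl⟩ := hx
      rw [auxE_generic]
      exact Algebra.subset_adjoin ⟨h, rfl⟩
    | algebraMap r =>
      rw [AlgHom.commutes, IsScalarTower.algebraMap_apply k R]
      exact Subalgebra.algebraMap_mem _ _
    | add x y _ _ hx hy => rw [map_add]; exact add_mem hx hy
    | mul x y _ _ hx hy => rw [map_mul]; exact mul_mem hx hy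
  induction hx using Algebra.adjoin_induction with
  | mem x hx =>
    rcases hx with hx | ⟨p, hp, rfl⟩
    · exact hG x hx
    · rw [traceScalar, auxE_algebraMap]
      exact Subalgebra.algebraMap_mem _ _
  | algebraMap r =>
    rw [AlgHom.commutes, IsScalarTower.algebraMap_apply k R]
    exact Subalgebra.algebraMap_mem _ _
  | add x y _ _ hx hy => rw [map_add]; exact add_mem hx hy
  | mul x y _ _ hx hy => rw [map_mul]; exact mul_mem hx hy
end

/-- scalars in the trace ring -/
def auxC (n m : ℕ) : Subalgebra k (PolyRing k n m) :=
  (TMN k n m).comap (IsScalarTower.toAlgHom k (PolyRing k n m) (MatPoly k n m))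

theorem mem_auxC {n m : ℕ} (f : PolyRing k n m) :
    f ∈ auxC k n m ↔ algebraMap (PolyRing k n m) (MatPoly k n m) f ∈ TMN k n m := Iff.rfl

theorem aux_trace_mem {n m : ℕ} (x : MatPoly k n m) (hx : x ∈ TMN k n m) :
    x.trace ∈ auxC k n m := by
  have h1 : x ∈ Algebra.adjoin (auxC k n m) (GMN k n m : Set (MatPoly k n m)) := by
    induction hx using Algebra.adjoin_induction with
    | mem x hx =>
      rcases hx with hx | ⟨p, hp, rfl⟩
      · exact Algebra.subset_adjoin hx
      · have : p.trace ∈ auxC k n m := by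
          rw [mem_auxC]
          exact Algebra.subset_adjoin (Or.inr ⟨p, hp, rfl⟩)
        exact Subalgebra.algebraMap_mem (Algebra.adjoin (auxC k n m) _)
          (⟨p.trace, this⟩ : auxC k n m)
    | algebraMap r =>
      rw [IsScalarTower.algebraMap_apply k (auxC k n m)]
      exact Subalgebra.algebraMap_mem _ _
    | add x y _ _ hx hy => exact add_mem hx hy
    | mul x y _ _ hx hy => exact mul_mem hx hy
  clear hx
  rw [← Subalgebra.mem_toSubmodule, Algebra.adjoin_eq_span] at h1
  induction h1 using Submodule.span_induction with
  | mem y hy =>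
    have hy' : y ∈ GMN k n m := by
      have : Submonoid.closure (GMN k n m : Set (MatPoly k n m)) ≤ (GMN k n m).toSubmonoid :=
        Submonoid.closure_le.mpr (fun _ h => h)
      exact this hy
    rw [mem_auxC]
    exact Algebra.subset_adjoin (Or.inr ⟨y, hy', rfl⟩)
  | zero => simp
  | add x y _ _ hx hy => rw [Matrix.trace_add]; exact add_mem hx hy
  | smul c y _ hy =>
    have : (c • y).trace = (c : PolyRing k n m) * y.trace := by
      change ((c : PolyRing k n m) • y).trace = _
      rw [Matrix.trace_smul, smul_eq_mul]
    rw [this]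
    exact mul_mem c.2 hy

/-- The trace of a trace ring element as a trace ring element. -/
def auxTr {n m : ℕ} (x : TMN k n m) : TMN k n m :=
  ⟨algebraMap _ _ (x : MatPoly k n m).trace, (mem_auxC k _).mp (aux_trace_mem k (x : MatPoly k n m) x.2)⟩

theorem aux_exists_point (n m : ℕ) (hn : 1 ≤ n)
    (J : TwoSidedIdeal ↥(TMN k n m)) (hJ : J ∈ SpecN n ↥(TMN k n m)) :
    ∃ (L : Type) (_ : Field L) (_ : Algebra k L) (b : Fin m → Matrix (Fin n) (Fin n) L),
      (∀ x : TMN k n m, x ∈ J ↔ auxE k b x = 0) ∧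
      Submodule.span L (auxE k b '' (TMN k n m)) = ⊤ := by
  obtain ⟨L, _, ψ, hψ, hspan⟩ := aux_split_R n hn _ hJ.2
  let φ : TMN k n m →+* Matrix (Fin n) (Fin n) L := ψ.comp J.ringCon.mk'
  have hmk : Function.Surjective J.ringCon.mk' := RingCon.mk'_surjective _
  have hφspan : Submodule.span L (Set.range φ) = ⊤ := by
    rw [← hspan]
    congr 1
    exact hmk.range_comp ψ
  have hφ : ∀ x, x ∈ J ↔ φ x = 0 := by
    intro x
    rw [TwoSidedIdeal.mem_iff, ← RingCon.eq, RingCon.coe_zero]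
    exact (map_eq_zero_iff ψ hψ).symm
  have hn' : Nonempty (Fin n) := ⟨⟨0, hn⟩⟩
  let i : auxC k n m →+* TMN k n m :=
    { toFun := fun c => ⟨algebraMap _ _ (c : PolyRing k n m), c.2⟩
      map_one' := by ext1; simp
      map_zero' := by ext1; simp
      map_mul' := fun x y => by ext1; simp
      map_add' := fun x y => by ext1; simp }
  have hsc : ∀ c, ∃ l : L, φ (i c) = algebraMap L _ l := by
    intro c
    refine aux_scalar_of_comm hn _ hφspan _ ?_
    rintro _ ⟨s, rfl⟩
    rw [← map_mul, ← map_mul]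
    congr 1
    ext1
    exact (Algebra.commutes _ _).symm
  choose χ0 hχ0 using hsc
  have hinj : Function.Injective (algebraMap L (Matrix (Fin n) (Fin n) L)) := RingHom.injective _
  let χ : auxC k n m →+* L :=
    { toFun := χ0
      map_one' := hinj (by rw [← hχ0]; simp)
      map_zero' := hinj (by rw [← hχ0]; simp)
      map_mul' := fun x y => hinj (by rw [← hχ0]; simp [hχ0])
      map_add' := fun x y => hinj (by rw [← hχ0]; simp [hχ0]) }
  let _ : Algebra k L := (χ.comp (algebraMap k (auxC k n m))).toAlgebra
  have hk : ∀ r : k, φ (algebraMap k _ r) = algebraMap k _ r := by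
    intro r
    have h1 : (algebraMap k (TMN k n m) r) = i (algebraMap k (auxC k n m) r) := by
      ext1
      rfl
    rw [h1, hχ0, IsScalarTower.algebraMap_apply k L (Matrix (Fin n) (Fin n) L)]
    rfl
  have : CharZero L := charZero_of_injective_algebraMap (algebraMap k L).injective
  have htr : ∀ x : TMN k n m, φ (auxTr k x) = algebraMap L _ (φ x).trace := by
    intro x
    have h1 := hχ0 ⟨_, aux_trace_mem k (x : MatPoly k n m) x.2⟩
    have h2 := aux_trace_compat hn (TMN k n m).val.toRingHom Subtype.val_injective φ hφspan x
      (auxTr k x) rfl _ h1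
    rw [← h2]
    exact h1
  let b : Fin m → Matrix (Fin n) (Fin n) L := fun h =>
    φ ⟨genericMatrix k n m h, GMN_le_TMN k n m (Algebra.subset_adjoin ⟨h, rfl⟩)⟩
  have hG : ∀ x (hx : x ∈ GMN k n m), auxE k b x = φ ⟨x, GMN_le_TMN k n m hx⟩ := by
    intro x hx
    induction hx using Algebra.adjoin_induction with
    | mem x hx =>
      obtain ⟨h, rfl⟩ := hx
      rw [auxE_generic]
    | algebraMap r =>
      rw [AlgHom.commutes]; exact (hk r).symm
    | add x y hx hy h1 h2 => rw [map_add, h1, h2, ← map_add]; rfl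
    | mul x y hx hy h1 h2 => rw [map_mul, h1, h2, ← map_mul]; rfl
  have hT : ∀ x (hx : x ∈ TMN k n m), auxE k b x = φ ⟨x, hx⟩ := by
    intro x hx
    induction hx using Algebra.adjoin_induction with
    | mem x hx =>
      rcases hx with hx | ⟨p, hp, rfl⟩
      · exact hG x hx
      · have h1 : auxE k b (traceScalar k p) =
            algebraMap L _ (φ ⟨p, GMN_le_TMN k n m hp⟩).trace := by
          rw [traceScalar, auxE_algebraMap, ← auxE_trace, hG p hp]
        exact h1.trans (htr ⟨p, GMN_le_TMN k n m hp⟩).symm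
    | algebraMap r =>
      rw [AlgHom.commutes]; exact (hk r).symm
    | add x y hx hy h1 h2 => rw [map_add, h1, h2, ← map_add]; rfl
    | mul x y hx hy h1 h2 => rw [map_mul, h1, h2, ← map_mul]; rfl
  refine ⟨L, inferInstance, inferInstance, b, ?_, ?_⟩
  · intro x
    rw [hT x x.2]
    exact hφ x
  · rw [← hφspan]
    congr 1
    ext y
    constructor
    · rintro ⟨x, hx, rfl⟩
      exact ⟨⟨x, hx⟩, (hT x hx).symm⟩
    · rintro ⟨x, rfl⟩
      exact ⟨x, x.2, hT x x.2⟩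
end AuxC

section AuxD

theorem aux_eval_surj_s7 {n m : ℕ} (a : MTuple k n m) (ha : a ∈ genTuples k n m)
    (y : Matrix (Fin n) (Fin n) k) : ∃ q : TMN k n m, auxE k a (q : MatPoly k n m) = y := by
  have h1 : y ∈ Algebra.adjoin k (Set.range a) := by
    have : Algebra.adjoin k (Set.range a) = ⊤ := ha
    rw [this]; trivial
  have h2 : Algebra.adjoin k (Set.range a) ≤ (TMN k n m).map (auxE k a) := by
    rw [Algebra.adjoin_le_iff]
    rintro _ ⟨h, rfl⟩
    exact ⟨genericMatrix k n m h, GMN_le_TMN k n m (Algebra.subset_adjoin ⟨h, rfl⟩),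
      auxE_generic k a h⟩
  obtain ⟨q, hq, rfl⟩ := h2 h1
  exact ⟨⟨q, hq⟩, rfl⟩

theorem aux_trace_invariant {n m : ℕ} (x : TMN k n m) :
    (auxTr k x : MatPoly k n m) ∈ CMNscalar k n m := by
  refine ⟨(x : MatPoly k n m).trace, ?_, rfl⟩
  intro g a
  have huv : (g : Matrix (Fin n) (Fin n) k) * ((g⁻¹ : GL (Fin n) k) : Matrix (Fin n) (Fin n) k) = 1 :=
    g.mul_inv
  have hvu : ((g⁻¹ : GL (Fin n) k) : Matrix (Fin n) (Fin n) k) * (g : Matrix (Fin n) (Fin n) k) = 1 :=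
    g.inv_mul
  change auxP k (fun h => (g : Matrix (Fin n) (Fin n) k) * a h *
    ((g⁻¹ : GL (Fin n) k) : Matrix (Fin n) (Fin n) k)) _ = auxP k a _
  rw [← auxE_trace, ← auxE_trace, auxT_conj k a _ _ huv _ x.2, Matrix.trace_mul_comm, ← mul_assoc,
    hvu, one_mul]

theorem aux_tr_mem {n m : ℕ} {J : TwoSidedIdeal ↥(TMN k n m)}
    {L : Type} [Field L] [Algebra k L] {b : Fin m → Matrix (Fin n) (Fin n) L}
    (hb : ∀ x : TMN k n m, x ∈ J ↔ auxE k b x = 0) (p : TMN k n m) (hp : p ∈ J) :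
    auxTr k p ∈ J := by
  rw [hb] at hp ⊢
  change auxE k b (algebraMap _ _ _) = 0
  rw [auxE_algebraMap, ← auxE_trace, hp, Matrix.trace_zero, map_zero]

theorem aux_part_a {n m : ℕ} (hn : 1 ≤ n) {J : TwoSidedIdeal ↥(TMN k n m)}
    {L : Type} [Field L] [Algebra k L] {b : Fin m → Matrix (Fin n) (Fin n) L}
    (hb : ∀ x : TMN k n m, x ∈ J ↔ auxE k b x = 0) :
    zeroLocusI k J =
      {a | a ∈ genTuples k n m ∧ ∀ p : ↥(TMN k n m), p ∈ J →
        (p : MatPoly k n m) ∈ CMNscalar k n m → evalMat k a (p : MatPoly k n m) = 0} := by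
  have : Nonempty (Fin n) := ⟨⟨0, hn⟩⟩
  ext a
  constructor
  · rintro ⟨h1, h2⟩
    exact ⟨h1, fun p hp _ => h2 p hp⟩
  · rintro ⟨h1, h2⟩
    refine ⟨h1, fun p hp => ?_⟩
    refine Matrix.ext_iff_trace_mul_right.mpr (fun y => ?_)
    obtain ⟨q, rfl⟩ := aux_eval_surj_s7 k a h1 y
    have h3 := h2 (auxTr k (p * q)) (aux_tr_mem k hb _ (J.mul_mem_right _ _ hp))
      (aux_trace_invariant k _)
    change auxE k a (algebraMap _ _ _) = 0 at h3
    rw [auxE_algebraMap, ← auxE_trace] at h3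
    have h4 := (map_eq_zero_iff _ (RingHom.injective (algebraMap k (Matrix (Fin n) (Fin n) k)))).mp h3
    rw [zero_mul, Matrix.trace_zero, ← h4]
    change _ = (auxE k a ((p : MatPoly k n m) * (q : MatPoly k n m))).trace
    rw [map_mul]
    rfl

theorem aux_null {n m : ℕ} {J : TwoSidedIdeal ↥(TMN k n m)}
    {B : Type} [CommRing B] [IsDomain B] [Algebra k B] (β : Fin m → Matrix (Fin n) (Fin n) B)
    (hβ : ∀ x : TMN k n m, x ∈ J → auxE k β x = 0)
    (δ : PolyRing k n m) (hδ : auxP k β δ ≠ 0)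
    (hU : ∀ a : MTuple k n m, polyEval k a δ ≠ 0 → a ∈ genTuples k n m)
    (f : PolyRing k n m) (hf : auxP k β f ≠ 0) :
    ∃ a ∈ zeroLocusI k J, polyEval k a f ≠ 0 := by
  let P : Ideal (PolyRing k n m) := RingHom.ker (auxP k β)
  have hP : P.IsPrime := RingHom.ker_isPrime _
  have h1 : δ * f ∉ P := by
    intro h
    have : auxP k β (δ * f) = 0 := h
    rw [map_mul] at this
    exact (mul_ne_zero hδ hf) this
  have h2 := MvPolynomial.vanishingIdeal_zeroLocus_eq_radical (K := k) P
  rw [hP.radical] at h2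
  rw [← h2] at h1
  rw [MvPolynomial.mem_vanishingIdeal_iff] at h1
  push Not at h1
  obtain ⟨z, hz, hzf⟩ := h1
  rw [MvPolynomial.mem_zeroLocus_iff] at hz
  let a : MTuple k n m := fun h => Matrix.of fun i j => z (h, i, j)
  have ha : ∀ q, polyEval k a q = MvPolynomial.aeval z q := fun q => rfl
  rw [← ha, map_mul] at hzf
  refine ⟨a, ⟨hU a (left_ne_zero_of_mul hzf), fun p hp => ?_⟩, right_ne_zero_of_mul hzf⟩
  ext i j
  change polyEval k a ((p : MatPoly k n m) i j) = 0
  rw [ha]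
  apply hz
  change auxP k β ((p : MatPoly k n m) i j) = 0
  rw [← auxE_apply, hβ p hp]
  rfl

theorem aux_delta {n m : ℕ} {L : Type} [Field L] [Algebra k L] {b : Fin m → Matrix (Fin n) (Fin n) L}
    (hs : Submodule.span L (auxE k b '' (TMN k n m)) = ⊤) :
    ∃ δ : PolyRing k n m, auxP k b δ ≠ 0 ∧
      ∀ a : MTuple k n m, polyEval k a δ ≠ 0 → a ∈ genTuples k n m := by
  classical
  let B := Module.Basis.ofSpan (K := L) (s := auxE k b '' (TMN k n m)) (by rw [hs])
  have hB : ∀ i, B i ∈ auxE k b '' (TMN k n m) := by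
    intro i
    exact Module.Basis.ofSpan_subset _ ⟨i, rfl⟩
  have := Module.Finite.finite_basis B
  have := Fintype.ofFinite
  have e : (Fin n × Fin n) ≃ _ := (Matrix.stdBasis L (Fin n) (Fin n)).indexEquiv B
  have hBe : ∀ s : Fin n × Fin n, ∃ y : TMN k n m, auxE k b y = B (e s) := by
    intro s
    obtain ⟨y, hy, h⟩ := hB (e s)
    exact ⟨⟨y, hy⟩, h⟩
  choose y hy using hBe
  let M : Matrix (Fin n × Fin n) (Fin n × Fin n) (PolyRing k n m) :=
    Matrix.of fun s t => (y t : MatPoly k n m) s.1 s.2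
  refine ⟨M.det, ?_, ?_⟩
  · rw [AlgHom.map_det]
    have : (auxP k b).mapMatrix M = (Matrix.stdBasis L (Fin n) (Fin n)).toMatrix (B.reindex e.symm) := by
      ext s t
      rw [Module.Basis.toMatrix_apply, Module.Basis.reindex_apply, e.symm_symm, ← hy]
      change _ = (auxE k b (y t)) s.1 s.2
      rfl
    rw [this]
    have h1 := Module.Basis.toMatrix_mul_toMatrix_flip (Matrix.stdBasis L (Fin n) (Fin n)) (B.reindex e.symm)
    have h2 := congrArg Matrix.det h1
    rw [Matrix.det_mul, Matrix.det_one] at h2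
    exact left_ne_zero_of_mul_eq_one h2
  · intro a ha
    rw [AlgHom.map_det] at ha
    have h1 : (polyEval k a).mapMatrix M = (Matrix.stdBasis k (Fin n) (Fin n)).toMatrix
      (fun s => auxE k a (y s)) := by
      ext s t
      rfl
    rw [h1, ← Module.Basis.det_apply] at ha
    have h2 := ((Matrix.stdBasis k (Fin n) (Fin n)).is_basis_iff_det).mpr (IsUnit.mk0 _ ha)
    change Algebra.adjoin k (Set.range a) = ⊤
    rw [eq_top_iff]
    intro x _
    have hx : x ∈ Submodule.span k (Set.range fun s => auxE k a (y s : MatPoly k n m)) := by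
      rw [h2.2]; trivial
    have h3 : Submodule.span k (Set.range fun s => auxE k a (y s : MatPoly k n m)) ≤
        Subalgebra.toSubmodule (Algebra.adjoin k (Set.range a)) := by
      rw [Submodule.span_le]
      rintro _ ⟨s, rfl⟩
      exact auxT_mem_adjoin k a _ (y s).2
    exact h3 hx
end AuxD

section AuxE

theorem aux_lattice {L : Type} [Field L] (O : ValuationSubring L) {n : ℕ} {ι : Type} [Finite ι]
    (u : ι → (Fin n → L)) (hu : Submodule.span L (Set.range u) = ⊤) :
    ∃ (τ : Fin n → ι) (c : ι → Fin n → O),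
      IsUnit (Matrix.of fun i j => u (τ j) i : Matrix (Fin n) (Fin n) L).det ∧
      ∀ t, u t = (Matrix.of fun i j => u (τ j) i : Matrix (Fin n) (Fin n) L).mulVec
        (fun i => (c t i : L)) := by
  classical
  let H : (Fin n → ι) → Matrix (Fin n) (Fin n) L := fun τ => Matrix.of fun i j => u (τ j) i
  have hex : ∃ τ, (H τ).det ≠ 0 := by
    let B := Module.Basis.ofSpan (K := L) (s := Set.range u) (by rw [hu])
    have hB : ∀ i, B i ∈ Set.range u := fun i => Module.Basis.ofSpan_subset _ ⟨i, rfl⟩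
    have e : Fin n ≃ _ := (Pi.basisFun L (Fin n)).indexEquiv B
    choose τ hτ using fun i => hB (e i)
    refine ⟨τ, ?_⟩
    have h1 := Module.Basis.toMatrix_mul_toMatrix_flip (Pi.basisFun L (Fin n)) (B.reindex e.symm)
    have h2 := congrArg Matrix.det h1
    rw [Matrix.det_mul, Matrix.det_one] at h2
    have h3 : H τ = (Pi.basisFun L (Fin n)).toMatrix (B.reindex e.symm) := by
      ext s t
      rw [Module.Basis.toMatrix_apply, Module.Basis.reindex_apply, e.symm_symm, ← hτ]
      simp [H]
    rw [h3]
    exact left_ne_zero_of_mul_eq_one h2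
  obtain ⟨τ0, h0⟩ := hex
  have : Nonempty (Fin n → ι) := ⟨τ0⟩
  obtain ⟨τ, hτ⟩ := Finite.exists_max (fun τ => O.valuation (H τ).det)
  have hne : (H τ).det ≠ 0 := by
    intro h
    have h1 := hτ τ0
    rw [h, map_zero, le_zero_iff, map_eq_zero] at h1
    exact h0 h1
  have hmem : ∀ t i, (H τ).cramer (u t) i / (H τ).det ∈ O := by
    intro t i
    rw [← ValuationSubring.valuation_le_one_iff, map_div₀]
    have h1 : (H τ).cramer (u t) i = (H (Function.update τ i t)).det := by
      rw [Matrix.cramer_apply]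
      congr 1
      ext a c
      by_cases hc : c = i
      · subst hc; simp [H]
      · simp [H, hc]
    rw [h1]
    exact div_le_one_of_le₀ (hτ _) zero_le
  refine ⟨τ, fun t i => ⟨_, hmem t i⟩, IsUnit.mk0 _ hne, fun t => ?_⟩
  have h2 := Matrix.mulVec_cramer (H τ) (u t)
  have h3 : (fun i => (H τ).cramer (u t) i / (H τ).det) = (H τ).det⁻¹ • (H τ).cramer (u t) := by
    ext i
    simp [div_eq_inv_mul]
  change u t = (H τ).mulVec (fun i => (H τ).cramer (u t) i / (H τ).det)
  rw [h3, Matrix.mulVec_smul, h2, smul_smul, inv_mul_cancel₀ hne, one_smul]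

theorem aux_gram {K : Type} [Field K] {n : ℕ} (Y Y' : Fin n × Fin n → Matrix (Fin n) (Fin n) K)
    (hΓ : IsUnit (Matrix.of fun s t => (Y' s * Y t).trace).det) (X : Matrix (Fin n) (Fin n) K) :
    X = ∑ s, (((Matrix.of fun s t => (Y' s * Y t).trace)⁻¹).mulVec
      (fun t => (Y' t * X).trace)) s • Y s := by
  classical
  set Γ : Matrix (Fin n × Fin n) (Fin n × Fin n) K := Matrix.of fun s t => (Y' s * Y t).trace with hΓd
  have key : ∀ c : Fin n × Fin n → K, (fun t => (Y' t * ∑ s, c s • Y s).trace) = Γ.mulVec c := by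
    intro c
    ext t
    simp [Matrix.mulVec, dotProduct, Finset.mul_sum, Matrix.trace_sum, hΓd, mul_comm]
  have hinv : ∀ c, Γ⁻¹.mulVec (Γ.mulVec c) = c := by
    intro c
    rw [Matrix.mulVec_mulVec, Matrix.nonsing_inv_mul _ hΓ, Matrix.one_mulVec]
  have hli : LinearIndependent K Y := by
    rw [Fintype.linearIndependent_iff]
    intro c hc
    have h1 := key c
    rw [hc] at h1
    have h2 := hinv c
    rw [← h1] at h2
    intro i
    rw [← h2]
    simp [Matrix.mulVec, dotProduct]
  have hsp := hli.span_eq_top_of_card_eq_finrank' (by simp [Module.finrank_matrix])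
  have hX : X ∈ Submodule.span K (Set.range Y) := by rw [hsp]; trivial
  obtain ⟨c, rfl⟩ := (Submodule.mem_span_range_iff_exists_fun K).mp hX
  rw [key, hinv]

theorem aux_matunits {K : Type} [Field K] {n : ℕ} (e : Fin n → Fin n → Matrix (Fin n) (Fin n) K)
    (hn : 1 ≤ n)
    (h1 : ∀ i j l, e i j * e j l = e i l) (h0 : ∀ i j j' l, j ≠ j' → e i j * e j' l = 0)
    (hs : ∑ i, e i i = 1) :
    ∃ g : Matrix (Fin n) (Fin n) K, IsUnit g.det ∧ ∀ i j, e i j * g = g * Matrix.single i j 1 := by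
  classical
  let z : Fin n := ⟨0, hn⟩
  have hz : e z z ≠ 0 := by
    intro h
    have h2 : ∀ i, e i i = 0 := by
      intro i
      rw [← h1 i z i, ← h1 i z z, h, mul_zero, zero_mul]
    have h3 : (1 : Matrix (Fin n) (Fin n) K) = 0 := by rw [← hs]; simp [h2]
    have h4 := congrFun (congrFun h3 z) z
    simp at h4
  have hw : ∃ u : Fin n → K, u ≠ 0 ∧ (e z z).mulVec u = u := by
    by_contra hcon
    push Not at hcon
    apply hz
    ext i j
    by_contra hne
    have h5 : (e z z).mulVec (Pi.single j 1) ≠ 0 := by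
      intro h
      have := congrFun h i
      simp at this
      exact hne this
    apply hcon _ h5
    rw [Matrix.mulVec_mulVec, h1]
  obtain ⟨u, hu, hzu⟩ := hw
  let g : Matrix (Fin n) (Fin n) K := Matrix.of fun i j => (e j z).mulVec u i
  have hcol : ∀ c, g.mulVec c = ∑ j, c j • (e j z).mulVec u := by
    intro c
    ext i
    simp [g, Matrix.mulVec, dotProduct, Finset.sum_apply, mul_comm]
  refine ⟨g, ?_, ?_⟩
  · rw [isUnit_iff_ne_zero]
    intro hdet
    obtain ⟨c, hc, hgc⟩ := Matrix.exists_mulVec_eq_zero_iff.mpr hdet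
    apply hc
    ext j
    rw [hcol] at hgc
    have h6 := congrArg (e z j).mulVec hgc
    rw [Matrix.mulVec_sum, Matrix.mulVec_zero, Finset.sum_eq_single j] at h6
    · rw [Matrix.mulVec_smul, Matrix.mulVec_mulVec, h1, hzu] at h6
      exact (smul_eq_zero.mp h6).resolve_right hu
    · intro l _ hl
      rw [Matrix.mulVec_smul, Matrix.mulVec_mulVec, h0 _ _ _ _ hl.symm, Matrix.zero_mulVec, smul_zero]
    · simp
  · intro i j
    ext p l
    have h7 : (e i j * g) p l = (e i j).mulVec ((e l z).mulVec u) p := rfl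
    rw [h7, Matrix.mulVec_mulVec]
    by_cases hl : l = j
    · subst hl
      rw [h1, Matrix.mul_single_apply_same]
      simp [g]
    · rw [h0 _ _ _ _ (Ne.symm hl), Matrix.mul_single_apply_of_ne _ _ _ _ _ hl]
      simp
end AuxE

section AuxF

theorem aux_valuation {n m : ℕ} (hn : 1 ≤ n) {J : TwoSidedIdeal ↥(TMN k n m)}
    {L : Type} [Field L] [Algebra k L] {b : Fin m → Matrix (Fin n) (Fin n) L}
    (hb : ∀ x : TMN k n m, x ∈ J ↔ auxE k b x = 0)
    (a : MTuple k n m) (ha : a ∈ zeroLocusI k J) :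
    ∃ O : ValuationSubring L, (∀ c ∈ auxC k n m, auxP k b c ∈ O) ∧
      (∀ c ∈ auxC k n m, auxP k a c = 0 → auxP k b c ∈ O.nonunits) := by
  have : Nonempty (Fin n) := ⟨⟨0, hn⟩⟩
  let χ : auxC k n m →+* L := ((auxP k b).comp (auxC k n m).val).toRingHom
  let η : auxC k n m →+* k := ((auxP k a).comp (auxC k n m).val).toRingHom
  let I : Ideal χ.range := (RingHom.ker η).map χ.rangeRestrict
  have hker : ∀ c, χ c = 0 → η c = 0 := by
    intro c hc
    have h1 : (⟨algebraMap _ _ (c : PolyRing k n m), c.2⟩ : TMN k n m) ∈ J := by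
      rw [hb]
      change auxE k b (algebraMap _ _ _) = 0
      rw [auxE_algebraMap]
      have : auxP k b (c : PolyRing k n m) = 0 := hc
      rw [this, map_zero]
    have h2 := ha.2 _ h1
    change auxE k a (algebraMap _ _ _) = 0 at h2
    rw [auxE_algebraMap] at h2
    exact (map_eq_zero_iff _ (RingHom.injective (algebraMap k (Matrix (Fin n) (Fin n) k)))).mp h2
  have hI : I ≠ ⊤ := by
    intro h
    have h1 : (1 : χ.range) ∈ I := by rw [h]; trivial
    obtain ⟨c, hc, hc1⟩ := (Ideal.mem_map_iff_of_surjective _ χ.rangeRestrict_surjective).mp h1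
    have h2 : χ (c - 1) = 0 := by
      have := congrArg Subtype.val hc1
      rw [map_sub, map_one, sub_eq_zero]
      exact this
    have h3 := hker _ h2
    rw [map_sub, map_one, RingHom.mem_ker.mp hc] at h3
    simp at h3
  obtain ⟨O, h1, h2⟩ := Ideal.image_subset_nonunits_valuationSubring I hI
  refine ⟨O, fun c hc => h1 ⟨⟨c, hc⟩, rfl⟩, fun c hc hc0 => h2 ?_⟩
  exact ⟨χ.rangeRestrict ⟨c, hc⟩, Ideal.mem_map_of_mem _ hc0, rfl⟩

theorem aux_coords {n m : ℕ}
    {L : Type} [Field L] [Algebra k L] {b : Fin m → Matrix (Fin n) (Fin n) L}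
    (a : MTuple k n m) (O : ValuationSubring L) [Algebra k O]
    (hO : ∀ c ∈ auxC k n m, ∃ o : O, (o : L) = auxP k b c ∧
      IsLocalRing.residue O o = algebraMap k (IsLocalRing.ResidueField O) (auxP k a c))
    (y : Fin n → Fin n → TMN k n m) (hy : ∀ i j, auxE k a (y i j) = Matrix.single i j 1) :
    ∀ x : TMN k n m, ∃ c : Fin n → Fin n → O,
      (auxE k b x = ∑ i, ∑ j, (c i j : L) • auxE k b (y i j)) ∧
      ∀ i j, IsLocalRing.residue O (c i j) =
        algebraMap k (IsLocalRing.ResidueField O) (auxE k a x i j) := by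
  classical
  have htr : ∀ x : TMN k n m, ∃ o : O, (o : L) = (auxE k b x).trace ∧
      IsLocalRing.residue O o = algebraMap k (IsLocalRing.ResidueField O) (auxE k a x).trace := by
    intro x
    rw [auxE_trace, auxE_trace]
    exact hO _ (aux_trace_mem k _ x.2)
  choose t ht1 ht2 using htr
  let Γ0 : Matrix (Fin n × Fin n) (Fin n × Fin n) O :=
    Matrix.of fun s r => t (y s.2 s.1 * y r.1 r.2)
  have hres : Γ0.map (IsLocalRing.residue O) = 1 := by
    ext s r
    simp only [Γ0, Matrix.map_apply, Matrix.of_apply, ht2]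
    have h1 : auxE k a ((y s.2 s.1 * y r.1 r.2 : TMN k n m) : MatPoly k n m) =
        Matrix.single s.2 s.1 1 * Matrix.single r.1 r.2 1 := by
      rw [← hy, ← hy, ← map_mul]; rfl
    rw [h1]
    by_cases h2 : s = r
    · subst h2
      simp
    · rw [Matrix.one_apply_ne h2]
      by_cases h3 : s.1 = r.1
      · have h4 : s.2 ≠ r.2 := fun h => h2 (Prod.ext h3 h)
        rw [h3, Matrix.single_mul_single_same, Matrix.trace_single_eq_of_ne _ _ _ h4, map_zero]
      · rw [Matrix.single_mul_single_of_ne _ _ _ _ h3, Matrix.trace_zero, map_zero]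
  have hdet : IsUnit Γ0.det := by
    rw [← IsLocalRing.residue_ne_zero_iff_isUnit, RingHom.map_det]
    change (Γ0.map (IsLocalRing.residue O)).det ≠ 0
    rw [hres, Matrix.det_one]
    exact one_ne_zero
  have hinvres : Γ0⁻¹.map (IsLocalRing.residue O) = 1 := by
    have h1 : (Γ0 * Γ0⁻¹).map (IsLocalRing.residue O) = 1 := by
      rw [Matrix.mul_nonsing_inv _ hdet]
      exact (IsLocalRing.residue O).mapMatrix.map_one
    rw [Matrix.map_mul, hres, one_mul] at h1
    exact h1
  let Y : Fin n × Fin n → Matrix (Fin n) (Fin n) L := fun s => auxE k b (y s.1 s.2)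
  let Y' : Fin n × Fin n → Matrix (Fin n) (Fin n) L := fun s => auxE k b (y s.2 s.1)
  have hΓ : (Matrix.of fun s r => (Y' s * Y r).trace) = Γ0.map O.subtype := by
    ext s r
    simp only [Γ0, Matrix.map_apply, Matrix.of_apply, Y, Y']
    rw [← map_mul]
    exact (ht1 (y s.2 s.1 * y r.1 r.2)).symm
  have hΓu : IsUnit (Matrix.of fun s r => (Y' s * Y r).trace).det := by
    rw [hΓ]
    change IsUnit (O.subtype.mapMatrix Γ0).det
    rw [← RingHom.map_det]
    exact hdet.map _
  have hΓinv : (Matrix.of fun s r => (Y' s * Y r).trace)⁻¹ = Γ0⁻¹.map O.subtype := by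
    apply Matrix.inv_eq_right_inv
    rw [hΓ, ← Matrix.map_mul, Matrix.mul_nonsing_inv _ hdet]
    exact O.subtype.mapMatrix.map_one
  intro x
  let c : Fin n × Fin n → O := Γ0⁻¹.mulVec (fun s => t (y s.2 s.1 * x))
  refine ⟨fun i j => c (i, j), ?_, ?_⟩
  · have h1 := aux_gram Y Y' hΓu (auxE k b x)
    rw [hΓinv] at h1
    have h2 : (Γ0⁻¹.map O.subtype).mulVec (fun s => (Y' s * auxE k b x).trace) =
        fun s => (c s : L) := by
      ext s
      have h3 : (fun s => (Y' s * auxE k b x).trace) = O.subtype ∘ (fun s => t (y s.2 s.1 * x)) := by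
        ext s
        simp only [Y', Function.comp]
        rw [← map_mul]
        exact (ht1 (y s.2 s.1 * x)).symm
      rw [h3]
      exact (RingHom.map_mulVec O.subtype Γ0⁻¹ (fun s => t (y s.2 s.1 * x)) s).symm
    rw [h2, Fintype.sum_prod_type] at h1
    exact h1
  · intro i j
    have h4 := RingHom.map_mulVec (IsLocalRing.residue O) Γ0⁻¹ (fun s => t (y s.2 s.1 * x)) (i, j)
    rw [hinvres, Matrix.one_mulVec] at h4
    refine h4.trans ?_
    simp only [Function.comp, ht2]
    congr 1
    have h5 : auxE k a ((y j i * x : TMN k n m) : MatPoly k n m) =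
        Matrix.single j i 1 * auxE k a x := by
      rw [← hy, ← map_mul]; rfl
    rw [h5, Matrix.trace_single_mul]
    simp
end AuxF

section AuxG

theorem aux_integral {n m : ℕ} (hn : 1 ≤ n)
    {L : Type} [Field L] [Algebra k L] {b : Fin m → Matrix (Fin n) (Fin n) L}
    (hs : Submodule.span L (auxE k b '' (TMN k n m)) = ⊤)
    (O : ValuationSubring L)
    (y : Fin n → Fin n → TMN k n m)
    (hc : ∀ x : TMN k n m, ∃ c : Fin n → Fin n → O,
      (auxE k b x = ∑ i, ∑ j, (c i j : L) • auxE k b (y i j))) :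
    ∃ h h' : Matrix (Fin n) (Fin n) L, h' * h = 1 ∧ ∀ x : TMN k n m,
      ∃ z : Matrix (Fin n) (Fin n) O, h' * auxE k b x * h = z.map O.subtype := by
  classical
  let v : Fin n → L := Pi.single ⟨0, hn⟩ 1
  let w : Fin n × Fin n → Fin n → L := fun s => (auxE k b (y s.1 s.2)).mulVec v
  have hxw : ∀ x : TMN k n m, ∃ c : Fin n × Fin n → O,
      (auxE k b x).mulVec v = ∑ s, (c s : L) • w s := by
    intro x
    obtain ⟨c, h⟩ := hc x
    refine ⟨fun s => c s.1 s.2, ?_⟩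
    rw [h, Fintype.sum_prod_type]
    simp only [Matrix.sum_mulVec, Matrix.smul_mulVec, w]
  have hw : Submodule.span L (Set.range w) = ⊤ := by
    rw [eq_top_iff]
    intro z _
    let e : Matrix (Fin n) (Fin n) L →ₗ[L] (Fin n → L) :=
      { toFun := fun A => A.mulVec v
        map_add' := fun A B => Matrix.add_mulVec A B v
        map_smul' := fun c A => Matrix.smul_mulVec c A v }
    have h1 : (Submodule.span L (auxE k b '' (TMN k n m))).map e ≤ Submodule.span L (Set.range w) := by
      rw [Submodule.map_span, Submodule.span_le]
      rintro _ ⟨_, ⟨x, hx, rfl⟩, rfl⟩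
      obtain ⟨c, h⟩ := hxw ⟨x, hx⟩
      change (auxE k b x).mulVec v ∈ Submodule.span L (Set.range w)
      rw [h]
      exact Submodule.sum_mem _ fun s _ => Submodule.smul_mem _ _ (Submodule.subset_span ⟨s, rfl⟩)
    rw [hs] at h1
    apply h1
    refine ⟨Matrix.of fun i j => if j = ⟨0, hn⟩ then z i else 0, trivial, ?_⟩
    ext i
    simp [e, v]
  obtain ⟨τ, c, hdet, hτ⟩ := aux_lattice O w hw
  set h : Matrix (Fin n) (Fin n) L := Matrix.of fun i j => w (τ j) i with hh
  refine ⟨h, h⁻¹, Matrix.nonsing_inv_mul _ hdet, fun x => ?_⟩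
  have hcol : ∀ j, ∃ d : Fin n → O, (auxE k b x * h).col j = h.mulVec (fun i => (d i : L)) := by
    intro j
    have h1 : (auxE k b x * h).col j = (auxE k b ((x * y (τ j).1 (τ j).2 : TMN k n m) : MatPoly k n m)).mulVec v := by
      have h2 : auxE k b ((x * y (τ j).1 (τ j).2 : TMN k n m) : MatPoly k n m) =
        auxE k b x * auxE k b (y (τ j).1 (τ j).2) := by rw [← map_mul]; rfl
      rw [h2, ← Matrix.mulVec_mulVec]
      rfl
    obtain ⟨d, hd⟩ := hxw (x * y (τ j).1 (τ j).2)
    refine ⟨fun i => ∑ s, d s * c s i, ?_⟩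
    rw [h1, hd]
    have h3 : (fun i => ((∑ s, d s * c s i : O) : L)) = ∑ s, (d s : L) • (fun i => (c s i : L)) := by
      ext i
      simp
    rw [h3, Matrix.mulVec_sum]
    refine Finset.sum_congr rfl fun s _ => ?_
    rw [Matrix.mulVec_smul, ← hτ]
  choose d hd using hcol
  refine ⟨Matrix.of fun i j => d j i, ?_⟩
  have h4 : auxE k b x * h = h * (Matrix.of fun i j => d j i : Matrix (Fin n) (Fin n) O).map O.subtype := by
    ext i j
    exact congrFun (hd j) i
  rw [mul_assoc, h4, ← mul_assoc, Matrix.nonsing_inv_mul _ hdet, one_mul]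

theorem aux_special_O {n m : ℕ} (hn : 1 ≤ n)
    {L : Type} [Field L] [Algebra k L] {b : Fin m → Matrix (Fin n) (Fin n) L}
    (hs : Submodule.span L (auxE k b '' (TMN k n m)) = ⊤)
    (a : MTuple k n m) (O : ValuationSubring L) [Algebra k O]
    (hkO : ∀ r : k, ((algebraMap k O r : O) : L) = algebraMap k L r)
    (y : Fin n → Fin n → TMN k n m) (hy : ∀ i j, auxE k a (y i j) = Matrix.single i j 1)
    (hc : ∀ x : TMN k n m, ∃ c : Fin n → Fin n → O,
      (auxE k b x = ∑ i, ∑ j, (c i j : L) • auxE k b (y i j)) ∧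
      ∀ i j, IsLocalRing.residue O (c i j) =
        algebraMap k (IsLocalRing.ResidueField O) (auxE k a x i j))
    (f : PolyRing k n m) (hf : auxP k a f ≠ 0) :
    ∃ u v : Matrix (Fin n) (Fin n) L, u * v = 1 ∧ auxP k (fun h => u * b h * v) f ≠ 0 := by
  classical
  obtain ⟨h, h', hh, hintg⟩ := aux_integral k hn hs O y
    (fun x => (hc x).imp fun c hc => hc.1)
  have hhh : h * h' = 1 := mul_eq_one_comm.mp hh
  let ι : O →ₐ[k] L := { O.subtype with commutes' := hkO }
  let ρ : O →ₐ[k] IsLocalRing.ResidueField O :=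
    { IsLocalRing.residue O with commutes' := fun r => rfl }
  have hιinj : Function.Injective ι := Subtype.val_injective
  have hb' : ∀ l, ∃ z : Matrix (Fin n) (Fin n) O, h' * b l * h = z.map ι := by
    intro l
    obtain ⟨z, hz⟩ := hintg ⟨genericMatrix k n m l, GMN_le_TMN k n m (Algebra.subset_adjoin ⟨l, rfl⟩)⟩
    refine ⟨z, ?_⟩
    rw [← auxE_generic k b l]
    exact hz
  choose b' hb' using hb'
  have hb'' : (fun l => h' * b l * h) = fun l => (b' l).map ι := funext hb'
  have hE : ∀ x : TMN k n m, h' * auxE k b x * h = (auxE k b' x).map ι := by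
    intro x
    rw [← auxT_conj k b h' h hh x x.2, hb'', auxE_map]
  have hE2 : ∀ x : TMN k n m, ∃ c : Fin n → Fin n → O,
      auxE k b' x = ∑ i, ∑ j, c i j • auxE k b' (y i j) ∧
      ∀ i j, ρ (c i j) = algebraMap k (IsLocalRing.ResidueField O) (auxE k a x i j) := by
    intro x
    obtain ⟨c, h1, h2⟩ := hc x
    refine ⟨c, ?_, h2⟩
    apply Matrix.map_injective hιinj
    dsimp only
    rw [← hE x, h1]
    have h3 : (∑ i, ∑ j, c i j • auxE k b' (y i j)).map ι =
        ∑ i, ∑ j, (c i j : L) • (auxE k b' (y i j)).map ι := by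
      ext p q
      simp only [Matrix.map_apply, Matrix.sum_apply, Matrix.smul_apply, smul_eq_mul, map_sum, map_mul]
      rfl
    rw [h3]
    simp only [Finset.mul_sum, Finset.sum_mul, Matrix.mul_smul, Matrix.smul_mul, hE]
  let ab : Fin m → Matrix (Fin n) (Fin n) (IsLocalRing.ResidueField O) := fun l => (b' l).map ρ
  have hE3 : ∀ x : TMN k n m, auxE k ab x = ∑ i, ∑ j,
      algebraMap k (IsLocalRing.ResidueField O) (auxE k a x i j) • auxE k ab (y i j) := by
    intro x
    obtain ⟨c, h1, h2⟩ := hE2 x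
    simp only [ab, auxE_map]
    rw [h1]
    ext p q
    simp only [Matrix.map_apply, Matrix.sum_apply, Matrix.smul_apply, smul_eq_mul, map_sum, map_mul, h2]
  let e : Fin n → Fin n → Matrix (Fin n) (Fin n) (IsLocalRing.ResidueField O) :=
    fun i j => auxE k ab (y i j)
  have hmul : ∀ i j i' j', auxE k a ((y i j * y i' j' : TMN k n m) : MatPoly k n m) =
      Matrix.single i j 1 * Matrix.single i' j' 1 := by
    intro i j i' j'
    rw [← hy, ← hy, ← map_mul]; rfl
  have hmul2 : ∀ i j i' j', e i j * e i' j' = auxE k ab ((y i j * y i' j' : TMN k n m) : MatPoly k n m) := by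
    intro i j i' j'
    simp only [e]
    rw [← map_mul]; rfl
  obtain ⟨g, hg, hge⟩ := aux_matunits e hn
    (by
      intro i j l
      rw [hmul2, hE3, hmul, Matrix.single_mul_single_same, Finset.sum_eq_single i,
        Finset.sum_eq_single l]
      · simp [e]
      · intro q _ hq
        simp [hq.symm]
      · simp
      · intro p _ hp
        simp [hp.symm]
      · simp)
    (by
      intro i j j' l hj
      rw [hmul2, hE3, hmul, Matrix.single_mul_single_of_ne _ _ _ _ hj]
      simp)
    (by
      have h1 := hE3 1
      have h2 : auxE k ab ((1 : TMN k n m) : MatPoly k n m) = 1 := map_one _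
      have h3 : auxE k a ((1 : TMN k n m) : MatPoly k n m) = 1 := map_one _
      rw [h2, h3] at h1
      rw [h1]
      refine Finset.sum_congr rfl fun i _ => ?_
      rw [Finset.sum_eq_single i]
      · simp [e]
      · intro q _ hq
        simp [hq.symm]
      · simp)
  have hconj : ∀ l, ab l * g = g * (a l).map (algebraMap k (IsLocalRing.ResidueField O)) := by
    intro l
    have h1 := hE3 ⟨genericMatrix k n m l, GMN_le_TMN k n m (Algebra.subset_adjoin ⟨l, rfl⟩)⟩
    rw [auxE_generic, auxE_generic] at h1
    rw [h1]
    have h2 : (a l).map (algebraMap k (IsLocalRing.ResidueField O)) =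
        ∑ i, ∑ j, algebraMap k (IsLocalRing.ResidueField O) (a l i j) • Matrix.single i j 1 := by
      conv_lhs => rw [Matrix.matrix_eq_sum_single ((a l).map (algebraMap k (IsLocalRing.ResidueField O)))]
      simp only [Matrix.smul_single, smul_eq_mul, mul_one, Matrix.map_apply]
    rw [h2]
    simp only [Finset.mul_sum, Finset.sum_mul, Matrix.mul_smul, Matrix.smul_mul]
    refine Finset.sum_congr rfl fun i _ => Finset.sum_congr rfl fun j _ => ?_
    rw [← hge]
  -- lift
  choose G0 hG0 using fun i j => IsLocalRing.residue_surjective (g i j)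
  let G : Matrix (Fin n) (Fin n) O := Matrix.of G0
  have hG : G.map ρ = g := by
    ext i j
    exact hG0 i j
  have hGdet : IsUnit G.det := by
    rw [← IsLocalRing.residue_ne_zero_iff_isUnit, RingHom.map_det]
    change (G.map ρ).det ≠ 0
    rw [hG]
    exact hg.ne_zero
  have hGG : G⁻¹ * G = 1 := Matrix.nonsing_inv_mul _ hGdet
  let β : Fin m → Matrix (Fin n) (Fin n) O := fun l => G⁻¹ * b' l * G
  have hmap1 : ∀ {S : Type} [CommRing S] [Algebra k S] (σ : O →ₐ[k] S),
      (1 : Matrix (Fin n) (Fin n) O).map σ = 1 := fun σ => Matrix.map_one _ (map_zero σ) (map_one σ)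
  have hβρ : (fun l => (β l).map ρ) = fun l => (a l).map (Algebra.ofId k (IsLocalRing.ResidueField O)) := by
    funext l
    simp only [β]
    rw [Matrix.map_mul, Matrix.map_mul, hG]
    have h1 := hconj l
    change (b' l).map ρ * g = _ at h1
    rw [mul_assoc, h1, ← mul_assoc]
    have h2 : G⁻¹.map ρ * g = 1 := by
      rw [← hG, ← Matrix.map_mul, hGG, hmap1]
    rw [h2, one_mul]
    rfl
  have hβι : (fun l => (β l).map ι) =
      fun l => (G⁻¹.map ι * h') * b l * (h * G.map ι) := by
    funext l
    simp only [β]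
    rw [Matrix.map_mul, Matrix.map_mul, ← hb']
    simp only [mul_assoc]
  refine ⟨G⁻¹.map ι * h', h * G.map ι, ?_, ?_⟩
  · calc G⁻¹.map ι * h' * (h * G.map ι) = G⁻¹.map ι * (h' * h) * G.map ι := by simp only [mul_assoc]
      _ = 1 := by rw [hh, mul_one, ← Matrix.map_mul, hGG, hmap1]
  · rw [← hβι, auxP_map]
    intro h0
    have h1 : auxP k β f = 0 := hιinj (h0.trans (map_zero ι).symm)
    have h2 := auxP_map k β ρ f
    rw [hβρ, auxP_map, h1, map_zero] at h2
    exact hf ((map_eq_zero_iff _ (RingHom.injective _)).mp h2)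

theorem aux_special {n m : ℕ} (hn : 1 ≤ n) {J : TwoSidedIdeal ↥(TMN k n m)}
    {L : Type} [Field L] [Algebra k L] {b : Fin m → Matrix (Fin n) (Fin n) L}
    (hb : ∀ x : TMN k n m, x ∈ J ↔ auxE k b x = 0)
    (hs : Submodule.span L (auxE k b '' (TMN k n m)) = ⊤)
    (a : MTuple k n m) (ha : a ∈ zeroLocusI k J)
    (f : PolyRing k n m) (hf : auxP k a f ≠ 0) :
    ∃ u v : Matrix (Fin n) (Fin n) L, u * v = 1 ∧ auxP k (fun h => u * b h * v) f ≠ 0 := by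
  obtain ⟨O, hO1, hO2⟩ := aux_valuation k hn hb a ha
  have hkmem : ∀ r : k, algebraMap k L r ∈ O := by
    intro r
    have := hO1 (algebraMap k _ r) (Subalgebra.algebraMap_mem _ r)
    rwa [AlgHom.commutes] at this
  let _ : Algebra k O := ((algebraMap k L).codRestrict O.toSubring hkmem).toAlgebra
  have hkO : ∀ r : k, ((algebraMap k O r : O) : L) = algebraMap k L r := fun r => rfl
  choose y hy using fun i j => aux_eval_surj_s7 k a ha.1 (Matrix.single i j 1)
  refine aux_special_O k hn hs a O hkO y hy (aux_coords k a O ?_ y hy) f hf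
  intro c hc
  refine ⟨⟨_, hO1 c hc⟩, rfl, ?_⟩
  have h1 : c - algebraMap k _ (auxP k a c) ∈ auxC k n m := sub_mem hc (Subalgebra.algebraMap_mem _ _)
  have h2 := hO2 _ h1 (by rw [map_sub, AlgHom.commutes]; simp)
  have h3 : (⟨_, hO1 c hc⟩ - algebraMap k O (auxP k a c) : O) ∈ IsLocalRing.maximalIdeal O := by
    rw [IsLocalRing.mem_maximalIdeal, mem_nonunits_iff]
    have h4 : ((⟨_, hO1 c hc⟩ - algebraMap k O (auxP k a c) : O) : L) ∈ O.nonunits := by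
      have h5 : ((⟨_, hO1 c hc⟩ - algebraMap k O (auxP k a c) : O) : L) =
          auxP k b (c - algebraMap k _ (auxP k a c)) := by
        rw [map_sub, AlgHom.commutes]; rfl
      rw [h5]; exact h2
    rw [ValuationSubring.coe_mem_nonunits_iff] at h4
    exact h4
  rw [← IsLocalRing.residue_eq_zero_iff, map_sub, sub_eq_zero] at h3
  exact h3
end AuxG

section AuxH

theorem aux_conj_point {n m : ℕ} {J : TwoSidedIdeal ↥(TMN k n m)}
    {L : Type} [Field L] [Algebra k L] {b : Fin m → Matrix (Fin n) (Fin n) L}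
    (hb : ∀ x : TMN k n m, x ∈ J ↔ auxE k b x = 0)
    (hs : Submodule.span L (auxE k b '' (TMN k n m)) = ⊤)
    (u v : Matrix (Fin n) (Fin n) L) (huv : u * v = 1) :
    (∀ x : TMN k n m, x ∈ J ↔ auxE k (fun h => u * b h * v) x = 0) ∧
    Submodule.span L (auxE k (fun h => u * b h * v) '' (TMN k n m)) = ⊤ := by
  have hvu : v * u = 1 := mul_eq_one_comm.mp huv
  have hback : ∀ A : Matrix (Fin n) (Fin n) L, v * (u * A * v) * u = A := by
    intro A
    calc v * (u * A * v) * u = (v * u) * A * (v * u) := by simp only [mul_assoc]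
      _ = A := by rw [hvu, one_mul, mul_one]
  have hback' : ∀ A : Matrix (Fin n) (Fin n) L, u * (v * A * u) * v = A := by
    intro A
    calc u * (v * A * u) * v = (u * v) * A * (u * v) := by simp only [mul_assoc]
      _ = A := by rw [huv, one_mul, mul_one]
  refine ⟨fun x => ?_, ?_⟩
  · rw [hb, auxT_conj k b u v huv x x.2]
    constructor
    · intro h; rw [h]; simp
    · intro h; rw [← hback (auxE k b x), h]; simp
  · rw [eq_top_iff]
    intro A _
    let e : Matrix (Fin n) (Fin n) L →ₗ[L] Matrix (Fin n) (Fin n) L :=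
      { toFun := fun A => u * A * v
        map_add' := fun A B => by rw [mul_add, add_mul]
        map_smul' := fun c A => by simp }
    have h1 : (Submodule.span L (auxE k b '' (TMN k n m))).map e ≤
        Submodule.span L (auxE k (fun h => u * b h * v) '' (TMN k n m)) := by
      rw [Submodule.map_span, Submodule.span_le]
      rintro _ ⟨_, ⟨x, hx, rfl⟩, rfl⟩
      exact Submodule.subset_span ⟨x, hx, auxT_conj k b u v huv x hx⟩
    rw [hs] at h1
    exact h1 ⟨v * A * u, trivial, hback' A⟩

theorem aux_combine {n m : ℕ} {J : TwoSidedIdeal ↥(TMN k n m)}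
    {L : Type} [Field L] [Algebra k L] {b : Fin m → Matrix (Fin n) (Fin n) L}
    (hb : ∀ x : TMN k n m, x ∈ J ↔ auxE k b x = 0)
    (hs : Submodule.span L (auxE k b '' (TMN k n m)) = ⊤)
    (u v : Matrix (Fin n) (Fin n) L) (huv : u * v = 1)
    (f₁ f₂ : PolyRing k n m) (hf₁ : auxP k b f₁ ≠ 0)
    (hf₂ : auxP k (fun h => u * b h * v) f₂ ≠ 0) :
    ∃ a ∈ zeroLocusI k J, polyEval k a f₁ ≠ 0 ∧ polyEval k a f₂ ≠ 0 := by
  classical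
  obtain ⟨δ, hδ, hU⟩ := aux_delta k hs
  let γ0 : Matrix (Fin n) (Fin n) (Polynomial L) :=
    1 + (Polynomial.X : Polynomial L) • (u - 1).map (algebraMap L (Polynomial L))
  let d := γ0.det
  let ev : L → (Polynomial L →ₐ[k] L) := fun s => (Polynomial.aeval s).restrictScalars k
  have hev : ∀ s, γ0.map (ev s) = 1 + s • (u - 1) := by
    intro s
    ext i j
    by_cases hij : i = j
    · subst hij; simp [γ0, ev]
    · simp [γ0, ev, hij]; exact mul_comm _ _
  have hev0 : γ0.map (ev 0) = 1 := by rw [hev]; simp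
  have hev1 : γ0.map (ev 1) = u := by rw [hev]; simp
  have hd0 : ev 0 d = 1 := by
    rw [show ev 0 d = (γ0.map (ev 0)).det from AlgHom.map_det _ _, hev0, Matrix.det_one]
  have hd1 : IsUnit (ev 1 d) := by
    rw [show ev 1 d = (γ0.map (ev 1)).det from AlgHom.map_det _ _, hev1]
    exact (Matrix.isUnit_iff_isUnit_det _).mp (IsUnit.of_mul_eq_one _ huv)
  have hdne : d ≠ 0 := by
    intro h; rw [h, map_zero] at hd0; exact zero_ne_one hd0
  let B := Localization.Away d
  have : IsDomain B := IsLocalization.isDomain_localization (powers_le_nonZeroDivisors_of_noZeroDivisors hdne)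
  have hlift : ∀ s, IsUnit (ev s d) → ∃ σ : B →ₐ[k] L, ∀ p, σ (algebraMap (Polynomial L) B p) = ev s p := by
    intro s hsu
    have hM : ∀ z : Submonoid.powers d, IsUnit (ev s z) := by
      rintro ⟨_, r, rfl⟩
      rw [map_pow]
      exact hsu.pow r
    exact ⟨IsLocalization.liftAlgHom (M := Submonoid.powers d) (S := B) hM, fun p => by simp⟩
  obtain ⟨σ0, hσ0⟩ := hlift 0 (by rw [hd0]; exact isUnit_one)
  obtain ⟨σ1, hσ1⟩ := hlift 1 hd1
  let i : L →ₐ[k] B := (IsScalarTower.toAlgHom k (Polynomial L) B).comp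
    (IsScalarTower.toAlgHom k L (Polynomial L))
  let γ : Matrix (Fin n) (Fin n) B := γ0.map (algebraMap (Polynomial L) B)
  have hγ : IsUnit γ.det := by
    have : γ.det = algebraMap (Polynomial L) B d := (RingHom.map_det _ _).symm
    rw [this]
    exact IsLocalization.Away.algebraMap_isUnit d
  have hγγ : γ * γ⁻¹ = 1 := Matrix.mul_nonsing_inv _ hγ
  let bB : Fin m → Matrix (Fin n) (Fin n) B := fun l => (b l).map i
  let β : Fin m → Matrix (Fin n) (Fin n) B := fun l => γ * bB l * γ⁻¹
  have hσi : ∀ s, ∀ σ : B →ₐ[k] L, (∀ p, σ (algebraMap (Polynomial L) B p) = ev s p) →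
      ∀ l, (bB l).map σ = b l := by
    intro s σ hσ l
    ext p q
    change σ (algebraMap (Polynomial L) B (algebraMap L (Polynomial L) (b l p q))) = _
    rw [hσ]
    simp [ev]
  have hσβ : ∀ s, ∀ σ : B →ₐ[k] L, (∀ p, σ (algebraMap (Polynomial L) B p) = ev s p) →
      ∀ g g' : Matrix (Fin n) (Fin n) L, γ0.map (ev s) = g → g * g' = 1 →
      (fun l => (β l).map σ) = fun l => g * b l * g' := by
    intro s σ hσ g g' hg hgg
    have h1 : γ.map σ = g := by
      rw [← hg]
      ext p q
      exact hσ _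
    have h2 : g * γ⁻¹.map σ = 1 := by
      rw [← h1, ← Matrix.map_mul, hγγ]
      exact Matrix.map_one _ (map_zero σ) (map_one σ)
    have h3 : γ⁻¹.map σ = g' := by
      calc γ⁻¹.map σ = (g' * g) * γ⁻¹.map σ := by rw [mul_eq_one_comm.mp hgg, one_mul]
        _ = g' := by rw [mul_assoc, h2, mul_one]
    funext l
    simp only [β]
    rw [Matrix.map_mul, Matrix.map_mul, h1, h3, hσi s σ hσ]
  have h0 : (fun l => (β l).map σ0) = b := by
    rw [hσβ 0 σ0 hσ0 1 1 hev0 (one_mul _)]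
    simp
  have h1 := hσβ 1 σ1 hσ1 u v hev1 huv
  have hne0 : ∀ f, auxP k b f ≠ 0 → auxP k β f ≠ 0 := by
    intro f hf h
    apply hf
    rw [← h0, auxP_map, h, map_zero]
  have hne1 : auxP k β f₂ ≠ 0 := by
    intro h
    apply hf₂
    rw [← h1, auxP_map, h, map_zero]
  obtain ⟨a, ha, haf⟩ := aux_null k (J := J) β
    (by
      intro x hx
      rw [auxT_conj k bB γ γ⁻¹ hγγ x x.2, auxE_map, (hb x).mp hx]
      simp)
    δ (hne0 _ hδ) hU (f₁ * f₂) (by rw [map_mul]; exact mul_ne_zero (hne0 _ hf₁) hne1)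
  rw [map_mul] at haf
  exact ⟨a, ha, left_ne_zero_of_mul haf, right_ne_zero_of_mul haf⟩
end AuxH

/-- **Statement 8** (Proposition prop.central.Tmn).  Let `J ∈ Spec_n(T_{m,n})`.
Then (a) `Z(J) = Z(J ∩ C_{m,n})`, and (b) `Z(J)` is irreducible. -/
theorem spec_T_zero_locus (n m : ℕ) (hn : 1 ≤ n) (hm : 2 ≤ m)
    (J : TwoSidedIdeal ↥(TMN k n m)) (hJ : J ∈ SpecN n ↥(TMN k n m)) :
    zeroLocusI k J =
      {a | a ∈ genTuples k n m ∧ ∀ p : ↥(TMN k n m), p ∈ J →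
        (p : MatPoly k n m) ∈ CMNscalar k n m → evalMat k a (p : MatPoly k n m) = 0} ∧
    IsIrredSubset k (zeroLocusI k J) := by
  obtain ⟨L, _, _, b, hb, hs⟩ := aux_exists_point k n m hn J hJ
  refine ⟨aux_part_a k hn hb, ?_, ?_⟩
  · obtain ⟨δ, hδ, hU⟩ := aux_delta k hs
    obtain ⟨a, ha, _⟩ := aux_null k b (fun x hx => (hb x).mp hx) δ hδ hU 1 (by simp)
    exact ⟨a, ha⟩
  · rintro C₁ C₂ ⟨S₁, rfl⟩ ⟨S₂, rfl⟩ hX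
    by_contra hcon
    rw [not_or, Set.not_subset, Set.not_subset] at hcon
    obtain ⟨⟨a₁, ha₁, h₁⟩, ⟨a₂, ha₂, h₂⟩⟩ := hcon
    simp only [Set.mem_ofPred_eq, not_forall] at h₁ h₂
    obtain ⟨f₁, hf₁, hne₁⟩ := h₁
    obtain ⟨f₂, hf₂, hne₂⟩ := h₂
    obtain ⟨u₁, v₁, huv₁, hp₁⟩ := aux_special k hn hb hs a₁ ha₁ f₁ hne₁
    obtain ⟨hb', hs'⟩ := aux_conj_point k hb hs u₁ v₁ huv₁
    obtain ⟨u₂, v₂, huv₂, hp₂⟩ := aux_special k hn hb' hs' a₂ ha₂ f₂ hne₂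
    obtain ⟨a, ha, hz₁, hz₂⟩ := aux_combine k hb' hs' u₂ v₂ huv₂ f₁ f₂ hp₁ hp₂
    rcases hX ha with h | h
    · exact hz₁ (h f₁ hf₁)
    · exact hz₂ (h f₂ hf₂)

end
end
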